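/- arXiv:1410.5804 — 3 statements merged into one kernel-verified Lean document; each statement's English description precedes it below -/
import Mathlib

section
/- For every integer r ≥ 1 and every θ ∈ (0, π], there exists δ > 0 with the following property: for all homomorphisms j, ρ : F_r → PSL(2,ℝ) from the free group F_r on r generators such that the action γ·x = ρ(γ) x j(γ)⁻¹ of F_r on PSL(2,ℝ) is properly discontinuous and admits a fundamental domain bounded by pairwise disjoint right AdS crooked planes, and for every γ ∈ F_r such that some lift A ∈ SL(2,ℝ) of ρ(γ) has |tr A| ≤ 2·cos(θ/2) (i.e. ρ(γ) is an elliptic rotation of angle at least θ in absolute value), one has λ(j(γ)) ≥ δ. -/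
noncomputable section

open Filter Topology Pointwise
open scoped UpperHalfPlane

/-- `SL(2,ℝ)`. -/
abbrev SL2 := Matrix.SpecialLinearGroup (Fin 2) ℝ

instance : TopologicalSpace SL2 :=
  TopologicalSpace.induced (fun A : SL2 => (A : Matrix (Fin 2) (Fin 2) ℝ)) inferInstance

/-- `PSL(2,ℝ) = SL(2,ℝ)/{±I}`. -/
abbrev PSL2 := SL2 ⧸ Subgroup.center SL2

/-- The Möbius action of an element of `PSL(2,ℝ)` on the upper half-plane,
computed via an (arbitrary) lift to `SL(2,ℝ)`; this is well defined since
`-I` acts trivially. -/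
def pslSMul (g : PSL2) (z : ℍ) : ℍ := (Quotient.out g) • z

/-- Image of a subset of `ℍ` under the Möbius action of `g ∈ PSL(2,ℝ)`. -/
def pslImg (g : PSL2) (s : Set ℍ) : Set ℍ := pslSMul g '' s

/-- A geodesic line of `ℍ`: the image of an isometric embedding of `ℝ` into `ℍ`. -/
def IsGeodesicLine (l : Set ℍ) : Prop := ∃ γ : ℝ → ℍ, Isometry γ ∧ Set.range γ = l

/-- The embedding of `ℍ` into the one-point compactification of `ℂ`. -/
def embH (z : ℍ) : OnePoint ℂ := ((z : ℂ) : OnePoint ℂ)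

/-- The embedding of `∂∞ℍ = ℝ ∪ {∞}` into the one-point compactification of `ℂ`. -/
def toC : OnePoint ℝ → OnePoint ℂ := OnePoint.map Complex.ofReal

/-- The vector `v(ξ) ∈ ℝ²` associated with a boundary point `ξ ∈ ℝ ∪ {∞}`:
`v(ξ) = (ξ, 1)` for `ξ ∈ ℝ` and `v(∞) = (1, 0)`. -/
def bvec (ξ : OnePoint ℝ) : Fin 2 → ℝ := Option.elim ξ ![1, 0] (fun r => ![r, 1])

/-- The extended Möbius action of `PSL(2,ℝ)` on `∂∞ℍ = ℝ ∪ {∞}`. -/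
def bdSMul (g : PSL2) (ξ : OnePoint ℝ) : OnePoint ℝ :=
  let w := ((Quotient.out g : SL2) : Matrix (Fin 2) (Fin 2) ℝ).mulVec (bvec ξ)
  if w 1 = 0 then OnePoint.infty else ((w 0 / w 1 : ℝ) : OnePoint ℝ)

/-- `ξ ∈ ℝ ∪ {∞}` is an endpoint of the geodesic line `l`: some isometric
parametrization of `l` tends to `ξ` (in the one-point compactification of `ℂ`). -/
def IsEndpoint (l : Set ℍ) (ξ : OnePoint ℝ) : Prop :=
  ∃ γ : ℝ → ℍ, Isometry γ ∧ Set.range γ = l ∧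
    Tendsto (fun t => embH (γ t)) atTop (𝓝 (toC ξ))

/-- `h ∈ PSL(2,ℝ)` has a nonattracting fixed point at `ξ ∈ ℝ ∪ {∞}`. -/
def HasNonattracting (h : PSL2) (ξ : OnePoint ℝ) : Prop :=
  ∃ A : SL2, (QuotientGroup.mk A : PSL2) = h ∧
    ∃ μ : ℝ, |μ| ≤ 1 ∧ (A : Matrix (Fin 2) (Fin 2) ℝ).mulVec (bvec ξ) = μ • bvec ξ

/-- `h ∈ PSL(2,ℝ)` has a nonrepelling fixed point at `ξ ∈ ℝ ∪ {∞}`. -/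
def HasNonrepelling (h : PSL2) (ξ : OnePoint ℝ) : Prop :=
  ∃ A : SL2, (QuotientGroup.mk A : PSL2) = h ∧
    ∃ μ : ℝ, 1 ≤ |μ| ∧ (A : Matrix (Fin 2) (Fin 2) ℝ).mulVec (bvec ξ) = μ • bvec ξ

/-- The right AdS crooked plane `C*(l)` centered at the identity. -/
def rightCrooked (l : Set ℍ) : Set PSL2 :=
  {h | (∃ x ∈ l, pslSMul h x = x) ∨ ∃ ξ, IsEndpoint l ξ ∧ HasNonattracting h ξ}

/-- The left AdS crooked plane `C(l)` centered at the identity. -/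
def leftCrooked (l : Set ℍ) : Set PSL2 :=
  {h | (∃ x ∈ l, pslSMul h x = x) ∨ ∃ ξ, IsEndpoint l ξ ∧ HasNonrepelling h ξ}

/-- A general right AdS crooked plane: a set of the form `g·C*(l)`. -/
def IsRightCrookedPlane (S : Set PSL2) : Prop :=
  ∃ (g : PSL2) (l : Set ℍ), IsGeodesicLine l ∧ S = (g * ·) '' rightCrooked l

/-- A general left AdS crooked plane: a set of the form `C(l)·g`. -/
def IsLeftCrookedPlane (S : Set PSL2) : Prop :=
  ∃ (g : PSL2) (l : Set ℍ), IsGeodesicLine l ∧ S = (· * g) '' leftCrooked l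

variable {Γ : Type*} [Group Γ]

/-- The action `γ·x = ρ(γ) x j(γ)⁻¹` of `Γ` on `PSL(2,ℝ)`, applied to a set. -/
def actImg (j ρ : Γ →* PSL2) (γ : Γ) (S : Set PSL2) : Set PSL2 :=
  (fun x => ρ γ * x * (j γ)⁻¹) '' S

/-- The action `γ·x = ρ(γ) x j(γ)⁻¹` is properly discontinuous. -/
def ProperlyDisc (j ρ : Γ →* PSL2) : Prop :=
  ∀ K : Set PSL2, IsCompact K → {γ : Γ | (actImg j ρ γ K ∩ K).Nonempty}.Finite

/-- `R` is a fundamental domain for the action `γ·x = ρ(γ) x j(γ)⁻¹`: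
`R` is closed, its translates cover `PSL(2,ℝ)`, and the interiors of the
translates are pairwise disjoint. -/
def IsFundDom (j ρ : Γ →* PSL2) (R : Set PSL2) : Prop :=
  IsClosed R ∧ (⋃ γ : Γ, actImg j ρ γ R) = Set.univ ∧
    Pairwise fun γ₁ γ₂ : Γ =>
      Disjoint (interior (actImg j ρ γ₁ R)) (interior (actImg j ρ γ₂ R))

/-- The action admits a fundamental domain bounded by pairwise disjoint
right AdS crooked planes. -/
def AdmitsRightCrookedFD (j ρ : Γ →* PSL2) : Prop :=
  ∃ (m : ℕ) (D : Fin m → Set PSL2), (∀ i, IsRightCrookedPlane (D i)) ∧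
    (∀ (γ γ' : Γ) (i i' : Fin m),
      actImg j ρ γ (D i) = actImg j ρ γ' (D i') ∨
      Disjoint (actImg j ρ γ (D i)) (actImg j ρ γ' (D i'))) ∧
    ∃ x ∈ (⋃ (γ : Γ) (i : Fin m), actImg j ρ γ (D i))ᶜ,
      IsFundDom j ρ
        (closure (connectedComponentIn (⋃ (γ : Γ) (i : Fin m), actImg j ρ γ (D i))ᶜ x))

/-- The action admits a fundamental domain bounded by pairwise disjoint
left AdS crooked planes. -/
def AdmitsLeftCrookedFD (j ρ : Γ →* PSL2) : Prop :=
  ∃ (m : ℕ) (D : Fin m → Set PSL2), (∀ i, IsLeftCrookedPlane (D i)) ∧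
    (∀ (γ γ' : Γ) (i i' : Fin m),
      actImg j ρ γ (D i) = actImg j ρ γ' (D i') ∨
      Disjoint (actImg j ρ γ (D i)) (actImg j ρ γ' (D i'))) ∧
    ∃ x ∈ (⋃ (γ : Γ) (i : Fin m), actImg j ρ γ (D i))ᶜ,
      IsFundDom j ρ
        (closure (connectedComponentIn (⋃ (γ : Γ) (i : Fin m), actImg j ρ γ (D i))ᶜ x))

/-- The translation length `λ(g) = inf_{p ∈ ℍ} d(p, g·p)`. -/
def transLength (g : PSL2) : ℝ := ⨅ p : ℍ, dist p (pslSMul g p)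

/-- `U` is a connected component of `S`. -/
def IsCC (S U : Set ℍ) : Prop := ∃ x ∈ S, connectedComponentIn S x = U

/-- `ξ ∈ ℝ ∪ {∞}` is an ideal point of `U ⊆ ℍ`: a limit of a sequence of points
of `U` in the one-point compactification of `ℂ`. -/
def IsIdealPoint (U : Set ℍ) (ξ : OnePoint ℝ) : Prop :=
  ∃ u : ℕ → ℍ, (∀ n, u n ∈ U) ∧ Tendsto (fun n => embH (u n)) atTop (𝓝 (toC ξ))

/-- The closed right crooked half-space `H̄*₊(l, U)`. -/
def closedRHS (l U : Set ℍ) : Set PSL2 :=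
  {h | (∃ x ∈ l ∪ U, pslSMul h x = x) ∨ ∃ ξ, IsIdealPoint U ξ ∧ HasNonattracting h ξ}

/-- The open right crooked half-space `H*₊(l, U)`. -/
def openRHS (l U : Set ℍ) : Set PSL2 :=
  {h | h ≠ 1 ∧ ((∃ x ∈ U, pslSMul h x = x) ∨
    ∃ ξ, IsIdealPoint U ξ ∧ ¬ IsEndpoint l ξ ∧ HasNonattracting h ξ)}

/-- The circle of (Euclidean) radius `c` in `ℍ` centered at `0`; for suitable `c`
this is a geodesic line of `ℍ`. -/
def circ (c : ℝ) : Set ℍ := {z : ℍ | ‖(z : ℂ)‖ = c}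

/-- The stem quadrant `SQ(ℓ)` for `ℓ = {|z| = 1/R}` transversely oriented towards `0`. -/
def SQell (R : ℝ) : Set PSL2 :=
  {h | ∃ (A : SL2) (α β v : ℝ), (QuotientGroup.mk A : PSL2) = h ∧
    (A : Matrix (Fin 2) (Fin 2) ℝ) = !![α, -v/R; v*R, β] ∧
    |α| < |β| ∧ 2*|v| < |α - β|}

/-- The inverse stem quadrant `SQ(ℓ')⁻¹` for `ℓ' = {|z| = R}` transversely
oriented towards `∞`. -/
def SQell'inv (R : ℝ) : Set PSL2 :=
  {h | ∃ (A : SL2) (α β v : ℝ), (QuotientGroup.mk A : PSL2) = h ∧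
    (A : Matrix (Fin 2) (Fin 2) ℝ) = !![α, v*R; -v/R, β] ∧
    |α| < |β| ∧ 2*|v| < |α - β|}

/-- The stem quadrant `SQ(ℓ')`. -/
def SQell' (R : ℝ) : Set PSL2 := {h | h⁻¹ ∈ SQell'inv R}

set_option linter.unusedSimpArgs false
set_option linter.unusedVariables false


open UpperHalfPlane in
lemma sl_coe (A : SL2) (z : ℍ) :
    ((A • z : ℍ) : ℂ) = ((A 0 0 : ℂ) * z + (A 0 1 : ℂ)) / ((A 1 0 : ℂ) * z + (A 1 1 : ℂ)) := by
  simpa using coe_specialLinearGroup_apply A z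

lemma sl_denom_ne (A : SL2) (z : ℍ) : ((A 1 0 : ℂ) * z + (A 1 1 : ℂ)) ≠ 0 :=
  UpperHalfPlane.denom_ne_zero A z

lemma sl_det (A : SL2) : A 0 0 * A 1 1 - A 0 1 * A 1 0 = 1 := by
  have := A.2
  rw [Matrix.det_fin_two] at this
  exact this

lemma sl_mul (A B : SL2) (i k : Fin 2) : (A * B) i k = A i 0 * B 0 k + A i 1 * B 1 k := by
  rw [Matrix.SpecialLinearGroup.coe_mul, Matrix.mul_apply, Fin.sum_univ_two]

lemma sl_inv00 (A : SL2) : A⁻¹ 0 0 = A 1 1 := by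
  rw [Matrix.SpecialLinearGroup.SL2_inv_expl]; rfl
lemma sl_inv01 (A : SL2) : A⁻¹ 0 1 = - A 0 1 := by
  rw [Matrix.SpecialLinearGroup.SL2_inv_expl]; rfl
lemma sl_inv10 (A : SL2) : A⁻¹ 1 0 = - A 1 0 := by
  rw [Matrix.SpecialLinearGroup.SL2_inv_expl]; rfl
lemma sl_inv11 (A : SL2) : A⁻¹ 1 1 = A 0 0 := by
  rw [Matrix.SpecialLinearGroup.SL2_inv_expl]; rfl

lemma sl_smul_iff (A : SL2) (z w : ℍ) :
    A • z = w ↔ (A 0 0 : ℂ) * z + (A 0 1 : ℂ) = w * ((A 1 0 : ℂ) * z + (A 1 1 : ℂ)) := by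
  rw [UpperHalfPlane.ext_iff, sl_coe, div_eq_iff (sl_denom_ne A z)]

/-- real and imaginary parts version -/
lemma sl_smul_iff' (A : SL2) (z w : ℍ) :
    A • z = w ↔ (A 0 0 * z.re + A 0 1 = w.re * (A 1 0 * z.re + A 1 1) - w.im * (A 1 0 * z.im)
      ∧ A 0 0 * z.im = w.re * (A 1 0 * z.im) + w.im * (A 1 0 * z.re + A 1 1)) := by
  rw [sl_smul_iff, Complex.ext_iff]
  simp

lemma sl_im (A : SL2) (z : ℍ) :
    (A • z).im = z.im / ((A 1 0 * z.re + A 1 1) ^ 2 + (A 1 0 * z.im) ^ 2) := by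
  have hd := sl_denom_ne A z
  have h := sl_coe A z
  have h2 : ((A • z : ℍ) : ℂ).im = (A • z).im := rfl
  rw [← h2, h, Complex.div_im]
  have hdet := sl_det A
  have hn : Complex.normSq ((A 1 0 : ℂ) * z + (A 1 1 : ℂ)) =
      (A 1 0 * z.re + A 1 1) ^ 2 + (A 1 0 * z.im) ^ 2 := by
    simp [Complex.normSq_apply]; ring
  have hne : (A 1 0 * z.re + A 1 1) ^ 2 + (A 1 0 * z.im) ^ 2 ≠ 0 := by
    rw [← hn]; exact fun h => hd (Complex.normSq_eq_zero.mp h)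
  rw [hn, ← sub_div]
  congr 1
  simp
  linear_combination z.im * hdet

lemma psl_mk (A : SL2) (z : ℍ) : pslSMul (QuotientGroup.mk A : PSL2) z = A • z := by
  unfold pslSMul
  have h : (QuotientGroup.mk (Quotient.out (QuotientGroup.mk A : PSL2)) : PSL2)
      = QuotientGroup.mk A := Quotient.out_eq _
  set C := Quotient.out (QuotientGroup.mk A : PSL2) with hC
  rw [QuotientGroup.eq] at h
  obtain ⟨r, hr, hs⟩ := Matrix.SpecialLinearGroup.mem_center_iff.mp h
  have hr2 : r ≠ 0 := by rintro rfl; simp at hr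
  have hZ : ∀ w : ℍ, (C⁻¹ * A) • w = w := by
    intro w
    rw [sl_smul_iff, ← hs]
    simp
    ring
  have := hZ z
  rw [mul_smul, inv_smul_eq_iff] at this
  exact this.symm

lemma psl_mul (g h : PSL2) (z : ℍ) : pslSMul (g * h) z = pslSMul g (pslSMul h z) := by
  obtain ⟨A, rfl⟩ := QuotientGroup.mk_surjective g
  obtain ⟨B, rfl⟩ := QuotientGroup.mk_surjective h
  rw [← QuotientGroup.mk_mul, psl_mk, psl_mk, psl_mk, mul_smul]

lemma psl_one (z : ℍ) : pslSMul 1 z = z := by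
  rw [← QuotientGroup.mk_one, psl_mk, one_smul]

lemma psl_dist (g : PSL2) (z w : ℍ) : dist (pslSMul g z) (pslSMul g w) = dist z w := by
  obtain ⟨A, rfl⟩ := QuotientGroup.mk_surjective g
  rw [psl_mk, psl_mk, dist_smul]

/-- The point `i e^s`. -/
def E (s : ℝ) : ℍ := UpperHalfPlane.mk ⟨0, Real.exp s⟩ (Real.exp_pos s)

@[simp] lemma E_re (s : ℝ) : (E s).re = 0 := rfl
@[simp] lemma E_im (s : ℝ) : (E s).im = Real.exp s := rfl
lemma E_isom : Isometry E := UpperHalfPlane.isometry_vertical_line 0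
lemma E_zero : E 0 = UpperHalfPlane.I := by
  apply UpperHalfPlane.ext_re_im <;> simp

lemma E_dist (s t : ℝ) : dist (E s) (E t) = |s - t| := by
  rw [E_isom.dist_eq, Real.dist_eq]

/-- rotations -/
def Rot (φ : ℝ) : SL2 := ⟨!![Real.cos φ, -Real.sin φ; Real.sin φ, Real.cos φ], by
  rw [Matrix.det_fin_two_of]; nlinarith [Real.sin_sq_add_cos_sq φ]⟩

lemma Rot00 (φ : ℝ) : Rot φ 0 0 = Real.cos φ := rfl
lemma Rot01 (φ : ℝ) : Rot φ 0 1 = -Real.sin φ := rfl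
lemma Rot10 (φ : ℝ) : Rot φ 1 0 = Real.sin φ := rfl
lemma Rot11 (φ : ℝ) : Rot φ 1 1 = Real.cos φ := rfl

lemma Rot_I (φ : ℝ) : Rot φ • UpperHalfPlane.I = UpperHalfPlane.I := by
  rw [sl_smul_iff', Rot00, Rot01, Rot10, Rot11]
  simp

lemma fix_I (A : SL2) (h : A • UpperHalfPlane.I = UpperHalfPlane.I) : ∃ φ, A = Rot φ := by
  rw [sl_smul_iff'] at h
  simp at h
  obtain ⟨h1, h2⟩ := h
  have hd := sl_det A
  have h3 : A 1 1 ^ 2 + A 1 0 ^ 2 = 1 := by rw [h1, h2] at hd; nlinarith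
  obtain ⟨φ, hφ⟩ : ∃ φ : ℝ, Real.cos φ = A 1 1 ∧ Real.sin φ = A 1 0 := by
    refine ⟨Complex.arg ⟨A 1 1, A 1 0⟩, ?_, ?_⟩
    · rw [Complex.cos_arg]
      · have : ‖(⟨A 1 1, A 1 0⟩ : ℂ)‖ = 1 := by
          rw [Complex.norm_eq_sqrt_sq_add_sq]; simp [h3]
        simp [this]
      · intro h; have := Complex.ext_iff.mp h; simp at this; rw [this.1, this.2] at h3; simp at h3
    · rw [Complex.sin_arg]
      have : ‖(⟨A 1 1, A 1 0⟩ : ℂ)‖ = 1 := by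
          rw [Complex.norm_eq_sqrt_sq_add_sq]; simp [h3]
      simp [this]
  refine ⟨φ, ?_⟩
  ext i j
  fin_cases i <;> fin_cases j <;> simp [Rot00, Rot01, Rot10, Rot11, hφ, h1, h2]

lemma continuous_Rot : Continuous Rot := by
  apply continuous_induced_rng.mpr
  refine continuous_matrix fun i j => ?_
  fin_cases i <;> fin_cases j <;> simp [Rot] <;> fun_prop

lemma top_eq : (instTopologicalSpaceSL2 : TopologicalSpace SL2) =
  Matrix.SpecialLinearGroup.instTopologicalSpace := rfl

instance : IsTopologicalGroup SL2 :=
  (inferInstance : @IsTopologicalGroup (Matrix.SpecialLinearGroup (Fin 2) ℝ)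
    Matrix.SpecialLinearGroup.instTopologicalSpace _)

instance : ContinuousSMul SL2 ℍ := UpperHalfPlane.instContinuousSMulSL2R

lemma cont_toSL : Continuous (UpperHalfPlane.toSL2R : ℍ → SL2) := UpperHalfPlane.continuous_toSL2R

example : IsTopologicalGroup PSL2 := inferInstance

lemma to_axis (w : ℍ) : ∃ φ s, 0 ≤ s ∧ Rot φ • w = E s := by
  have hcont : Continuous fun φ => (Rot φ • w).re := by
    have : Continuous fun φ => Rot φ • w := continuous_Rot.smul continuous_const
    exact UpperHalfPlane.continuous_re.comp this
  have hS : (Rot (Real.pi / 2) • w).re * (w.re ^ 2 + w.im ^ 2) = - w.re := by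
    have h := (sl_smul_iff' (Rot (Real.pi / 2)) w _).mp rfl
    simp only [Rot00, Rot01, Rot10, Rot11, Real.cos_pi_div_two, Real.sin_pi_div_two] at h
    obtain ⟨h1, h2⟩ := h
    linear_combination (-w.re) * h1 - w.im * h2
  have h0 : (Rot 0 • w).re = w.re := by
    have : Rot 0 = 1 := by
      ext i j; fin_cases i <;> fin_cases j <;> simp [Rot]
    rw [this, one_smul]
  have hpos : 0 < w.re ^ 2 + w.im ^ 2 := by have := w.im_pos; positivity
  have hz : ∃ φ, (Rot φ • w).re = 0 := by
    have hu := isPreconnected_univ (α := ℝ)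
    rcases le_total 0 w.re with h | h
    · obtain ⟨φ, -, hφ⟩ := hu.intermediate_value (Set.mem_univ (Real.pi / 2)) (Set.mem_univ 0)
        hcont.continuousOn (show (0:ℝ) ∈ Set.Icc _ _ from ⟨by nlinarith, by rw [h0]; exact h⟩)
      exact ⟨φ, hφ⟩
    · obtain ⟨φ, -, hφ⟩ := hu.intermediate_value (Set.mem_univ 0) (Set.mem_univ (Real.pi / 2))
        hcont.continuousOn (show (0:ℝ) ∈ Set.Icc _ _ from ⟨by rw [h0]; exact h, by nlinarith⟩)
      exact ⟨φ, hφ⟩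
  obtain ⟨φ, hφ⟩ := hz
  have h1 : Rot φ • w = E (Real.log (Rot φ • w).im) := by
    apply UpperHalfPlane.ext_re_im
    · simpa using hφ
    · rw [E_im, Real.exp_log (UpperHalfPlane.im_pos _)]
  set s := Real.log (Rot φ • w).im
  rcases le_total 0 s with h | h
  · exact ⟨φ, s, h, h1⟩
  · refine ⟨Real.pi / 2 + φ, -s, by linarith, ?_⟩
    have : Rot (Real.pi / 2 + φ) = Rot (Real.pi / 2) * Rot φ := by
      ext i j; fin_cases i <;> fin_cases j <;>
        simp [sl_mul, Rot00, Rot01, Rot10, Rot11, Real.cos_add, Real.sin_add]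
    rw [this, mul_smul, h1, sl_smul_iff']
    simp only [Rot00, Rot01, Rot10, Rot11, Real.cos_pi_div_two, Real.sin_pi_div_two]
    simp [← Real.exp_add]

lemma to_axis2 (x y : ℍ) : ∃ A : SL2, A • x = E 0 ∧ A • y = E (dist x y) := by
  obtain ⟨φ, s, hs, h⟩ := to_axis ((UpperHalfPlane.toSL2R x)⁻¹ • y)
  have hx : (Rot φ * (UpperHalfPlane.toSL2R x)⁻¹ : SL2) • x = E 0 := by
    have : (UpperHalfPlane.toSL2R x)⁻¹ • x = UpperHalfPlane.I := by
      rw [inv_smul_eq_iff, UpperHalfPlane.toSL2R_smul_I]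
    rw [mul_smul, this, Rot_I, E_zero]
  have hy : (Rot φ * (UpperHalfPlane.toSL2R x)⁻¹ : SL2) • y = E s := by
    rw [mul_smul, h]
  refine ⟨_, hx, ?_⟩
  rw [hy]
  have : dist x y = s := by
    rw [← dist_smul (Rot φ * (UpperHalfPlane.toSL2R x)⁻¹ : SL2) x y, hx, hy, E_dist]
    simpa using hs
  rw [this]

lemma two_point (x y x' y' : ℍ) (h : dist x y = dist x' y') :
    ∃ A : SL2, A • x = x' ∧ A • y = y' := by
  obtain ⟨A, h1, h2⟩ := to_axis2 x y
  obtain ⟨B, h3, h4⟩ := to_axis2 x' y'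
  refine ⟨B⁻¹ * A, ?_, ?_⟩
  · rw [mul_smul, inv_smul_eq_iff, h1, h3]
  · rw [mul_smul, inv_smul_eq_iff, h2, h4, h]

lemma E_unique (t : ℝ) (z : ℍ) (h0 : dist z (E 0) = |t|) (h1 : dist z (E 1) = |t - 1|) :
    z = E t := by
  have key : ∀ s u : ℝ, dist z (E s) = |u| →
      z.re ^ 2 + z.im ^ 2 + Real.exp s ^ 2 = z.im * Real.exp s * (Real.exp u + Real.exp (-u)) := by
    intro s u h
    have := UpperHalfPlane.cosh_dist' z (E s)
    rw [h, Real.cosh_abs, Real.cosh_eq] at this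
    simp only [E_re, E_im, sub_zero] at this
    have hz := z.im_pos
    have he := Real.exp_pos s
    field_simp at this
    linarith
  have k0 := key 0 t h0
  have k1 := key 1 (t - 1) h1
  have e1 : Real.exp 1 * Real.exp (t - 1) = Real.exp t := by rw [← Real.exp_add]; congr 1; ring
  have e2 : Real.exp (-(t - 1)) = Real.exp 1 * Real.exp (-t) := by
    rw [← Real.exp_add]; congr 1; ring
  have e3 : Real.exp t * Real.exp (-t) = 1 := by rw [← Real.exp_add]; simp
  have e4 : 1 < Real.exp 1 := by simp
  have hy : z.im = Real.exp t := by
    rw [Real.exp_zero] at k0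
    rw [e2] at k1
    have : (z.im * Real.exp (-t) - 1) * (Real.exp 1 ^ 2 - 1) = 0 := by
      linear_combination k0 - k1 - z.im * e1
    have h5 : z.im * Real.exp (-t) - 1 = 0 := by
      rcases mul_eq_zero.mp this with h | h
      · exact h
      · nlinarith
    calc z.im = z.im * (Real.exp t * Real.exp (-t)) := by rw [e3, mul_one]
      _ = (z.im * Real.exp (-t)) * Real.exp t := by ring
      _ = Real.exp t := by rw [show z.im * Real.exp (-t) = 1 by linarith, one_mul]
  apply UpperHalfPlane.ext_re_im
  · rw [E_re]
    rw [hy, Real.exp_zero] at k0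
    have : z.re ^ 2 = 0 := by linear_combination k0 + e3
    simpa using this
  · simpa using hy

/-- Parametrized geodesics. -/
lemma geod_form (γ : ℝ → ℍ) (hγ : Isometry γ) : ∃ B : SL2, ∀ t, γ t = B • E t := by
  obtain ⟨B, h0, h1⟩ := two_point (E 0) (E 1) (γ 0) (γ 1) (by
    rw [hγ.dist_eq, E_isom.dist_eq])
  refine ⟨B, fun t => ?_⟩
  rw [← inv_smul_eq_iff]
  apply E_unique
  · rw [← dist_smul B, smul_inv_smul, h0, hγ.dist_eq, Real.dist_eq, sub_zero]
  · rw [← dist_smul B, smul_inv_smul, h1, hγ.dist_eq, Real.dist_eq]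


/-- The forward endpoint of the geodesic `s ↦ B • E s`. -/
def bpt (B : SL2) : OnePoint ℝ :=
  if B 1 0 = 0 then OnePoint.infty else ((B 0 0 / B 1 0 : ℝ) : OnePoint ℝ)

lemma bpt_tendsto (B : SL2) :
    Tendsto (fun s => embH (B • E s)) atTop (𝓝 (toC (bpt B))) := by
  unfold embH bpt
  by_cases hc : B 1 0 = 0
  · rw [if_pos hc]
    have h1 : toC OnePoint.infty = OnePoint.infty := rfl
    rw [h1]
    have hd : B 1 1 ≠ 0 := by
      intro h; have := sl_det B; rw [h, hc] at this; simp at this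
    have h2 : Tendsto (fun s : ℝ => ((B • E s : ℍ) : ℂ)) atTop (cocompact ℂ) := by
      rw [← Metric.cobounded_eq_cocompact, ← tendsto_norm_atTop_iff_cobounded]
      have h3 : ∀ s, Real.exp s / B 1 1 ^ 2 ≤ ‖((B • E s : ℍ) : ℂ)‖ := by
        intro s
        have := Complex.abs_im_le_norm ((B • E s : ℍ) : ℂ)
        have h4 := sl_im B (E s)
        rw [hc] at h4
        simp at h4
        have h5 : ((B • E s : ℍ) : ℂ).im = Real.exp s / B 1 1 ^ 2 := h4
        rw [h5] at this
        exact le_trans (le_abs_self _) this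
      refine tendsto_atTop_mono h3 ?_
      exact Real.tendsto_exp_atTop.atTop_div_const (by positivity)
    have h3 := OnePoint.tendsto_coe_infty (X := ℂ)
    rw [Filter.coclosedCompact_eq_cocompact] at h3
    exact h3.comp h2
  · rw [if_neg hc]
    have h1 : toC ((B 0 0 / B 1 0 : ℝ) : OnePoint ℝ) = (((B 0 0 / B 1 0 : ℝ) : ℂ) : OnePoint ℂ) :=
      rfl
    rw [h1]
    refine (OnePoint.continuous_coe.tendsto _).comp ?_
    have hE : ∀ s, ((E s : ℍ) : ℂ) = (Real.exp s : ℂ) * Complex.I := by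
      intro s
      apply Complex.ext
      · simp
      · simp [Complex.exp_ofReal_re]
    have h2 : ∀ s, ((B • E s : ℍ) : ℂ) = ((B 0 0 : ℂ) + B 0 1 * (-Complex.I * (Real.exp (-s) : ℝ)))
        / (B 1 0 + B 1 1 * (-Complex.I * (Real.exp (-s) : ℝ))) := by
      intro s
      rw [sl_coe, hE]
      have hx : ((Real.exp s : ℝ) : ℂ) * Complex.I ≠ 0 := by
        simp [Complex.exp_ne_zero]
      have hy : ((Real.exp s : ℝ) : ℂ) * ((Real.exp (-s) : ℝ) : ℂ) = 1 := by
        rw [← Complex.ofReal_mul, ← Real.exp_add]; simp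
      conv_rhs => rw [← mul_div_mul_right _ _ hx]
      congr 1
      · linear_combination (B 0 1 * (Complex.I ^ 2) : ℂ) * hy + (B 0 1 : ℂ) * Complex.I_sq
      · linear_combination (B 1 1 * (Complex.I ^ 2) : ℂ) * hy + (B 1 1 : ℂ) * Complex.I_sq
    simp_rw [h2]
    have h3 : Tendsto (fun s : ℝ => -Complex.I * ((Real.exp (-s) : ℝ) : ℂ)) atTop (𝓝 (-Complex.I * ((0 : ℝ) : ℂ))) := by
      refine Tendsto.const_mul _ ?_
      exact (Complex.continuous_ofReal.tendsto 0).comp Real.tendsto_exp_neg_atTop_nhds_zero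
    have h4 := ((tendsto_const_nhds (x := (B 0 0 : ℂ))).add (h3.const_mul (B 0 1 : ℂ))).div
      ((tendsto_const_nhds (x := (B 1 0 : ℂ))).add (h3.const_mul (B 1 1 : ℂ))) (by simpa using hc)
    simpa using! h4

lemma bvec_bpt (B : SL2) : ∃ κ : ℝ, κ ≠ 0 ∧ bvec (bpt B) = κ • ![B 0 0, B 1 0] := by
  unfold bpt
  by_cases hc : B 1 0 = 0
  · have ha : B 0 0 ≠ 0 := by
      intro h; have := sl_det B; rw [h, hc] at this; simp at this
    refine ⟨(B 0 0)⁻¹, by positivity, ?_⟩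
    rw [if_pos hc]
    ext i; fin_cases i <;> simp [bvec, ha, hc, OnePoint.infty]
  · refine ⟨(B 1 0)⁻¹, by positivity, ?_⟩
    rw [if_neg hc]
    ext i; fin_cases i <;> simp [bvec, hc, OnePoint.some]
    field_simp

lemma nonattr_iff (A B : SL2) : HasNonattracting (QuotientGroup.mk A) (bpt B) ↔
    (B⁻¹ * A * B) 1 0 = 0 ∧ |(B⁻¹ * A * B) 0 0| ≤ 1 := by
  obtain ⟨κ, hκ, hv⟩ := bvec_bpt B
  have hdet := sl_det B
  have e10 : (B⁻¹ * A * B) 1 0 = - B 1 0 * (A 0 0 * B 0 0 + A 0 1 * B 1 0)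
      + B 0 0 * (A 1 0 * B 0 0 + A 1 1 * B 1 0) := by
    simp only [sl_mul, sl_inv10, sl_inv11]; ring
  have e00 : (B⁻¹ * A * B) 0 0 = B 1 1 * (A 0 0 * B 0 0 + A 0 1 * B 1 0)
      - B 0 1 * (A 1 0 * B 0 0 + A 1 1 * B 1 0) := by
    simp only [sl_mul, sl_inv00, sl_inv01]; ring
  rw [e10, e00]
  constructor
  · rintro ⟨A', hA', μ, hμ, h⟩
    rw [eq_comm, QuotientGroup.eq] at hA'
    obtain ⟨r, hr, hs⟩ := Matrix.SpecialLinearGroup.mem_center_iff.mp hA'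
    simp at hr
    have hA2 : ∀ i k, A' i k = A i k * r := by
      have : A' = A * (A⁻¹ * A') := by group
      intro i k
      rw [this, sl_mul, ← hs]
      fin_cases k <;> simp
    have h0 := congrFun h 0
    have h1 := congrFun h 1
    rw [hv] at h0 h1
    simp [Matrix.mulVec, dotProduct, Fin.sum_univ_two, hA2] at h0 h1
    have h0' : (A 0 0 * B 0 0 + A 0 1 * B 1 0) * r = μ * B 0 0 := by
      apply mul_left_cancel₀ hκ; linear_combination h0
    have h1' : (A 1 0 * B 0 0 + A 1 1 * B 1 0) * r = μ * B 1 0 := by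
      apply mul_left_cancel₀ hκ; linear_combination h1
    have hr2 : r = 1 ∨ r = -1 := hr
    constructor
    · rcases hr2 with rfl | rfl
      · linear_combination -B 1 0 * h0' + B 0 0 * h1'
      · linear_combination B 1 0 * h0' - B 0 0 * h1'
    · rcases hr2 with rfl | rfl
      · have : B 1 1 * (A 0 0 * B 0 0 + A 0 1 * B 1 0)
          - B 0 1 * (A 1 0 * B 0 0 + A 1 1 * B 1 0) = μ := by
          linear_combination B 1 1 * h0' - B 0 1 * h1' + μ * hdet
        rwa [this]
      · have : B 1 1 * (A 0 0 * B 0 0 + A 0 1 * B 1 0)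
          - B 0 1 * (A 1 0 * B 0 0 + A 1 1 * B 1 0) = -μ := by
          linear_combination -B 1 1 * h0' + B 0 1 * h1' - μ * hdet
        rwa [this, abs_neg]
  · rintro ⟨h1, h2⟩
    refine ⟨A, rfl, _, h2, ?_⟩
    rw [hv]
    ext i
    fin_cases i
    · simp [Matrix.mulVec, dotProduct, Fin.sum_univ_two]
      linear_combination -κ * (A 0 0 * B 0 0 + A 0 1 * B 1 0) * hdet + κ * B 0 1 * h1
    · simp [Matrix.mulVec, dotProduct, Fin.sum_univ_two]
      linear_combination -κ * (A 1 0 * B 0 0 + A 1 1 * B 1 0) * hdet + κ * B 1 1 * h1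

/-- The flip. -/
def W : SL2 := Rot (Real.pi / 2)

lemma W_E (s : ℝ) : W • E s = E (-s) := by
  unfold W
  rw [sl_smul_iff']
  simp only [Rot00, Rot01, Rot10, Rot11, Real.cos_pi_div_two, Real.sin_pi_div_two]
  simp [← Real.exp_add]

/-- The geodesic line associated with `B`. -/
def lineB (B : SL2) : Set ℍ := Set.range fun s => B • E s

lemma line_form (l : Set ℍ) (h : IsGeodesicLine l) : ∃ B, l = lineB B := by
  obtain ⟨γ, hγ, rfl⟩ := h
  obtain ⟨B, hB⟩ := geod_form γ hγ
  exact ⟨B, by unfold lineB; congr 1; ext1 t; exact hB t⟩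

lemma lineB_W (B : SL2) : lineB (B * W) = lineB B := by
  unfold lineB
  ext z
  constructor
  · rintro ⟨s, rfl⟩
    exact ⟨-s, by simp only [mul_smul, W_E]⟩
  · rintro ⟨s, rfl⟩
    exact ⟨-s, by simp only [mul_smul, W_E, neg_neg]⟩

lemma endpoint_bpt (B : SL2) : IsEndpoint (lineB B) (bpt B) :=
  ⟨fun s => B • E s, (isometry_smul ℍ B).comp E_isom, rfl, bpt_tendsto B⟩

lemma toC_inj : Function.Injective toC := by
  apply Option.map_injective
  exact Complex.ofReal_injective

lemma endpoint_cases (B : SL2) (ξ : OnePoint ℝ) (h : IsEndpoint (lineB B) ξ) :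
    ξ = bpt B ∨ ξ = bpt (B * W) := by
  obtain ⟨γ, hγ, hr, ht⟩ := h
  have hs : ∀ t, ∃ s, B • E s = γ t := by
    intro t
    have : γ t ∈ lineB B := hr ▸ Set.mem_range_self t
    exact this
  choose s hs using hs
  have hd : ∀ t u, |s t - s u| = |t - u| := by
    intro t u
    rw [← E_dist, ← dist_smul B, hs, hs, hγ.dist_eq, Real.dist_eq]
  have h1 : s 1 - s 0 = 1 ∨ s 1 - s 0 = -1 := by
    have := hd 1 0
    rw [sub_zero, abs_one] at this
    exact eq_or_eq_neg_of_abs_eq this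
  rcases h1 with h1 | h1
  · left
    have h2 : ∀ t, γ t = B • E (t + s 0) := by
      intro t
      rw [← hs]
      congr 2
      have a1 := sq_eq_sq_iff_abs_eq_abs (s t - s 0) (t - 0) |>.mpr (hd t 0)
      have a2 := sq_eq_sq_iff_abs_eq_abs (s t - s 1) (t - 1) |>.mpr (hd t 1)
      have : s 1 = s 0 + 1 := by linarith
      rw [this] at a2
      linarith
    simp_rw [h2] at ht
    have h3 := (bpt_tendsto B).comp (tendsto_atTop_add_const_right atTop (s 0) tendsto_id)
    exact toC_inj (tendsto_nhds_unique ht h3)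
  · right
    have h2 : ∀ t, γ t = (B * W) • E (t - s 0) := by
      intro t
      rw [← hs, mul_smul, W_E]
      congr 2
      have a1 := sq_eq_sq_iff_abs_eq_abs (s t - s 0) (t - 0) |>.mpr (hd t 0)
      have a2 := sq_eq_sq_iff_abs_eq_abs (s t - s 1) (t - 1) |>.mpr (hd t 1)
      have : s 1 = s 0 - 1 := by linarith
      rw [this] at a2
      linarith
    simp_rw [h2] at ht
    have h3 := (bpt_tendsto (B * W)).comp (tendsto_atTop_add_const_right atTop (-s 0) tendsto_id)
    exact toC_inj (tendsto_nhds_unique ht h3)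

lemma crooked_cases (A B : SL2) (h : (QuotientGroup.mk A : PSL2) ∈ rightCrooked (lineB B)) :
    (∃ s, A • (B • E s) = B • E s) ∨
    ((B⁻¹ * A * B) 1 0 = 0 ∧ |(B⁻¹ * A * B) 0 0| ≤ 1) ∨
    (((B * W)⁻¹ * A * (B * W)) 1 0 = 0 ∧ |((B * W)⁻¹ * A * (B * W)) 0 0| ≤ 1) := by
  rcases h with ⟨x, ⟨s, rfl⟩, hx⟩ | ⟨ξ, hξ, hn⟩
  · left
    rw [psl_mk] at hx
    exact ⟨s, hx⟩
  · right
    rcases endpoint_cases B ξ hξ with rfl | rfl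
    · left; exact (nonattr_iff A B).mp hn
    · right; exact (nonattr_iff A (B * W)).mp hn

lemma crooked_of_fix (g : PSL2) (l : Set ℍ) (x : ℍ) (hx : x ∈ l) (h : pslSMul g x = x) :
    g ∈ rightCrooked l := Or.inl ⟨x, hx, h⟩

lemma crooked_of_nonattr (A B : SL2) (h1 : (B⁻¹ * A * B) 1 0 = 0)
    (h2 : |(B⁻¹ * A * B) 0 0| ≤ 1) : (QuotientGroup.mk A : PSL2) ∈ rightCrooked (lineB B) :=
  Or.inr ⟨bpt B, endpoint_bpt B, (nonattr_iff A B).mpr ⟨h1, h2⟩⟩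


lemma quad_lim (α β γ : ℝ) (h : ∀ t > 0, α * t ^ 2 ≤ β * t + γ) : α ≤ 0 := by
  by_contra hα
  push Not at hα
  set t := (|β| + |γ| + 1) / α + 1 with ht
  have h0 : 0 < (|β| + |γ| + 1) / α := by positivity
  have h1 : 1 ≤ t := by linarith
  have h2 : α * t = |β| + |γ| + 1 + α := by rw [ht]; field_simp
  have h3 := h t (by linarith)
  have h4 : β * t ≤ |β| * t := mul_le_mul_of_nonneg_right (le_abs_self β) (by linarith)
  have h5 : γ ≤ |γ| * t := (le_abs_self γ).trans (le_mul_of_one_le_right (abs_nonneg _) h1)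
  nlinarith

lemma cosh_E (z : ℍ) (s : ℝ) : 2 * z.im * Real.exp s * Real.cosh (dist z (E s)) =
    z.re ^ 2 + z.im ^ 2 + Real.exp s ^ 2 := by
  have h1 := z.im_pos
  have h2 := Real.exp_pos s
  rw [UpperHalfPlane.cosh_dist']
  simp only [E_re, E_im]
  field_simp
  ring

lemma lim_a (z w : ℍ) (h : ∀ s, dist w (E s) ≤ dist z (E s)) : z.im ≤ w.im := by
  have h1 := z.im_pos
  have h2 := w.im_pos
  have := quad_lim (z.im - w.im) 0 (w.im * (z.re ^ 2 + z.im ^ 2)) ?_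
  · linarith
  intro t ht
  have h3 := h (Real.log t)
  have h4 := cosh_E z (Real.log t)
  have h5 := cosh_E w (Real.log t)
  rw [Real.exp_log ht] at h4 h5
  have h6 : Real.cosh (dist w (E (Real.log t))) ≤ Real.cosh (dist z (E (Real.log t))) :=
    Real.cosh_le_cosh.mpr (by rwa [abs_of_nonneg dist_nonneg, abs_of_nonneg dist_nonneg])
  have h7 : z.im * (w.re ^ 2 + w.im ^ 2 + t ^ 2) ≤ w.im * (z.re ^ 2 + z.im ^ 2 + t ^ 2) := by
    rw [← h4, ← h5]
    have : 0 ≤ 2 * z.im * w.im * t := by positivity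
    nlinarith [mul_le_mul_of_nonneg_left h6 this]
  nlinarith [mul_nonneg h1.le (add_nonneg (sq_nonneg w.re) (sq_nonneg w.im))]

lemma lim_b (z w : ℍ) (h : ∀ s, dist z (E s) ≤ dist w (E s) - 2 / 5) : w.im < z.im := by
  have h1 := z.im_pos
  have h2 := w.im_pos
  set κ := Real.exp (-(2/5)) with hκ
  have hκ1 : κ < 1 := by rw [hκ, Real.exp_lt_one_iff]; norm_num
  have hκ0 : 0 < κ := Real.exp_pos _
  have := quad_lim (w.im - κ * z.im) (z.im * w.im) (z.im * (w.re ^ 2 + w.im ^ 2)) ?_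
  · nlinarith
  intro t ht
  have h3 := h (Real.log t)
  have h4 := cosh_E z (Real.log t)
  have h5 := cosh_E w (Real.log t)
  rw [Real.exp_log ht] at h4 h5
  set a := dist z (E (Real.log t))
  set b := dist w (E (Real.log t))
  have ha : 0 ≤ a := dist_nonneg
  have h6 : Real.cosh a ≤ κ * Real.cosh b + 1 / 2 := by
    rw [Real.cosh_eq, Real.cosh_eq]
    have e1 : Real.exp a ≤ κ * Real.exp b := by
      rw [hκ, ← Real.exp_add]; exact Real.exp_le_exp.mpr (by linarith)
    have e2 : Real.exp (-a) ≤ 1 := Real.exp_le_one_iff.mpr (by linarith)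
    nlinarith [mul_pos hκ0 (Real.exp_pos (-b))]
  have h7 : w.im * (z.re ^ 2 + z.im ^ 2 + t ^ 2) ≤
      κ * z.im * (w.re ^ 2 + w.im ^ 2 + t ^ 2) + z.im * w.im * t := by
    rw [← h4, ← h5]
    have : 0 ≤ 2 * z.im * w.im * t := by positivity
    nlinarith [mul_le_mul_of_nonneg_left h6 this]
  have h8 : 0 ≤ (1 - κ) * (z.im * (w.re ^ 2 + w.im ^ 2)) :=
    mul_nonneg (by linarith) (by positivity)
  nlinarith [mul_nonneg h2.le (add_nonneg (sq_nonneg z.re) (sq_nonneg z.im))]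

lemma rot_T (T : ℝ) : ∃ φ, 0 < Real.sin φ ∧ Real.cos φ = T * Real.sin φ := by
  refine ⟨Real.pi / 2 - Real.arctan T, ?_, ?_⟩
  · rw [Real.sin_pi_div_two_sub]; exact Real.cos_arctan_pos T
  · rw [Real.sin_pi_div_two_sub, Real.cos_pi_div_two_sub]
    have := Real.tan_arctan T
    rw [Real.tan_eq_sin_div_cos] at this
    have h := (Real.cos_arctan_pos T).ne'
    field_simp at this
    linarith

lemma lemN0 (B P Q : SL2) (hP : P 1 0 = 0) (hQ : Q 1 0 = 0) (hp : 0 < P 0 0) (hq : 0 < Q 0 0)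
    (h : ∀ φ, (QuotientGroup.mk (B * (P * Rot φ * Q⁻¹) * B⁻¹) : PSL2) ∈ rightCrooked (lineB B)) :
    P 0 0 = Q 0 0 ∧ P 0 1 = Q 0 1 := by
  obtain ⟨p, hpe⟩ : ∃ p, p = P 0 0 := ⟨_, rfl⟩
  obtain ⟨m, hme⟩ : ∃ p, p = Q 0 0 := ⟨_, rfl⟩
  obtain ⟨q, hqe⟩ : ∃ p, p = P 0 1 := ⟨_, rfl⟩
  obtain ⟨n, hne⟩ : ∃ p, p = Q 0 1 := ⟨_, rfl⟩
  have hP1 : P 1 1 = p⁻¹ := by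
    have := sl_det P; rw [hP] at this
    rw [hpe]; field_simp; linarith
  have hQ1 : Q 1 1 = m⁻¹ := by
    have := sl_det Q; rw [hQ] at this
    rw [hme]; field_simp; linarith
  rw [← hpe] at hp
  rw [← hme] at hq
  rw [← hpe, ← hme, ← hqe, ← hne]
  have key : ∀ φ, 0 < Real.sin φ →
      (Real.cos φ * (m * q - n * p) - Real.sin φ * (n * q + m * p) = 0) ∨
      ((p * Real.cos φ + q * Real.sin φ) / m = - n * Real.sin φ / p + m * Real.cos φ / p ∧
        Real.cos φ * (m * q - n * p) - Real.sin φ * (n * q + m * p) < 0) := by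
    intro φ hφ
    set N := P * Rot φ * Q⁻¹ with hN
    have n00 : N 0 0 = (p * Real.cos φ + q * Real.sin φ) / m := by
      simp only [hN, sl_mul, sl_inv00, sl_inv01, sl_inv10, sl_inv11, Rot00, Rot01, Rot10, Rot11, hP, hQ, hP1, hQ1, ← hpe, ← hme, ← hqe, ← hne]
      field_simp; ring
    have n01 : N 0 1 = Real.cos φ * (m * q - n * p) - Real.sin φ * (n * q + m * p) := by
      simp only [hN, sl_mul, sl_inv00, sl_inv01, sl_inv10, sl_inv11, Rot00, Rot01, Rot10, Rot11, hP, hQ, hP1, hQ1, ← hpe, ← hme, ← hqe, ← hne]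
      ring
    have n10 : N 1 0 = Real.sin φ / (p * m) := by
      simp only [hN, sl_mul, sl_inv00, sl_inv01, sl_inv10, sl_inv11, Rot00, Rot01, Rot10, Rot11, hP, hQ, hP1, hQ1, ← hpe, ← hme, ← hqe, ← hne]
      field_simp; ring
    have n11 : N 1 1 = - n * Real.sin φ / p + m * Real.cos φ / p := by
      simp only [hN, sl_mul, sl_inv00, sl_inv01, sl_inv10, sl_inv11, Rot00, Rot01, Rot10, Rot11, hP, hQ, hP1, hQ1, ← hpe, ← hme, ← hqe, ← hne]
      field_simp; ring
    have hc : 0 < N 1 0 := by rw [n10]; positivity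
    have h1 := crooked_cases _ _ (h φ)
    rw [← hN] at h1
    have e1 : B⁻¹ * (B * N * B⁻¹) * B = N := by group
    have e2 : (B * W)⁻¹ * (B * N * B⁻¹) * (B * W) = W⁻¹ * N * W := by group
    rw [e1, e2] at h1
    rw [← n00, ← n01, ← n11]
    rcases h1 with ⟨s, hs⟩ | ⟨h1, -⟩ | ⟨h1, -⟩
    · right
      have e3 : N • E s = E s := by
        have := congrArg (fun z => B⁻¹ • z) hs
        simpa [← mul_smul, mul_assoc] using this
      rw [sl_smul_iff'] at e3
      simp only [E_re, E_im] at e3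
      have := Real.exp_pos s
      refine ⟨?_, ?_⟩
      · have := e3.2
        have h3 : Real.exp s * (N 0 0 - N 1 1) = 0 := by linear_combination this
        rcases mul_eq_zero.mp h3 with h4 | h4
        · linarith
        · linarith
      · have h3 := e3.1
        have : 0 < Real.exp s * (N 1 0 * Real.exp s) := by positivity
        linarith
    · exact absurd h1 hc.ne'
    · left
      simp only [W, sl_mul, sl_inv00, sl_inv01, sl_inv10, sl_inv11, Rot00, Rot01, Rot10, Rot11, Real.cos_pi_div_two, Real.sin_pi_div_two] at h1
      linarith
  have hX : m * q - n * p = 0 := by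
    by_contra hX
    obtain ⟨φ, h1, h2⟩ := rot_T ((n * q + m * p + 1) / (m * q - n * p))
    have h3 : Real.cos φ * (m * q - n * p) = (n * q + m * p + 1) * Real.sin φ := by
      rw [h2, mul_right_comm, div_mul_cancel₀ _ hX]
    rcases key φ h1 with h4 | ⟨-, h4⟩ <;> rw [h3] at h4 <;> linarith
  have hY : 0 < n * q + m * p := by
    have h1 : 0 ≤ m * (n * q) := by
      have : m * (n * q) = n ^ 2 * p := by linear_combination n * hX
      rw [this]; positivity
    have h2 : 0 ≤ n * q := nonneg_of_mul_nonneg_right h1 hq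
    have := mul_pos hq hp
    linarith
  have key2 : ∀ T : ℝ, p * (p * T + q) = m * (-n + m * T) := by
    intro T
    obtain ⟨φ, h1, h2⟩ := rot_T T
    rcases key φ h1 with h4 | ⟨h4, -⟩
    · rw [hX] at h4
      have := mul_pos h1 hY
      linarith
    · rw [h2] at h4
      field_simp at h4
      linear_combination h4
  have k0 := key2 0
  have k1 := key2 1
  have hpm : p = m := by
    have : (p - m) * (p + m) = 0 := by linear_combination k1 - k0
    rcases mul_eq_zero.mp this with h | h <;> linarith
  refine ⟨hpm, ?_⟩
  subst hpm
  have : p * (q - n) = 0 := by linear_combination hX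
  rcases mul_eq_zero.mp this with h | h <;> linarith

lemma toSL_entries (z : ℍ) : UpperHalfPlane.toSL2R z 1 0 = 0 ∧ 0 < UpperHalfPlane.toSL2R z 0 0 ∧
    UpperHalfPlane.toSL2R z 0 0 = √z.im := by
  have h := UpperHalfPlane.coe_toSL2R z
  refine ⟨?_, ?_, ?_⟩
  · have := congrFun (congrFun h 1) 0; simpa using this
  · have := congrFun (congrFun h 0) 0
    have h2 := z.im_pos
    simp only [Matrix.of_apply, Matrix.cons_val_zero] at this
    exact (by positivity : 0 < √z.im).trans_eq (by simpa using this.symm)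
  · have := congrFun (congrFun h 0) 0; simpa using this

lemma toSL_I (z : ℍ) : UpperHalfPlane.toSL2R z • UpperHalfPlane.I = z := UpperHalfPlane.toSL2R_smul_I z

lemma toSL_inv (z : ℍ) : (UpperHalfPlane.toSL2R z)⁻¹ • z = UpperHalfPlane.I := by
  rw [inv_smul_eq_iff]; exact (toSL_I z).symm

lemma ut_ext (P Q : SL2) (hP : P 1 0 = 0) (hQ : Q 1 0 = 0) (hp : 0 < P 0 0)
    (h1 : P 0 0 = Q 0 0) (h2 : P 0 1 = Q 0 1) : P = Q := by
  have d1 := sl_det P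
  have d2 := sl_det Q
  have : P 1 1 = Q 1 1 := by
    rw [hP] at d1; rw [hQ, ← h1] at d2
    have : P 0 0 * (P 1 1 - Q 1 1) = 0 := by linarith
    rcases mul_eq_zero.mp this with h | h <;> linarith
  ext i k
  fin_cases i <;> fin_cases k <;> simp_all

lemma lemN (B : SL2) (y z : ℍ)
    (h : ∀ A : SL2, A • y = z → (QuotientGroup.mk A : PSL2) ∈ rightCrooked (lineB B)) : y = z := by
  set P := UpperHalfPlane.toSL2R (B⁻¹ • z) with hP
  set Q := UpperHalfPlane.toSL2R (B⁻¹ • y) with hQ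
  have h1 := lemN0 B P Q (toSL_entries _).1 (toSL_entries _).1 (toSL_entries _).2.1 (toSL_entries _).2.1 ?_
  · have h2 : P = Q := ut_ext P Q (toSL_entries _).1 (toSL_entries _).1 (toSL_entries _).2.1 h1.1 h1.2
    have h3 : B⁻¹ • z = B⁻¹ • y := by
      rw [← toSL_I (B⁻¹ • z), ← toSL_I (B⁻¹ • y), ← hP, ← hQ, h2]
    exact (smul_left_cancel _ h3).symm
  · intro φ
    apply h
    simp only [mul_smul]
    rw [toSL_inv, Rot_I, toSL_I, smul_inv_smul]


lemma pos_of_never_zero (F : ℝ → ℝ) (hF : Continuous F) (h0 : ∀ s, F s ≠ 0) (s : ℝ) (hs : 0 < F s) (t : ℝ) :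
    0 < F t := by
  by_contra h
  push Not at h
  have := (isPreconnected_univ (α := ℝ)).intermediate_value (Set.mem_univ t) (Set.mem_univ s) hF.continuousOn
  obtain ⟨u, -, hu⟩ := this ⟨h, hs.le⟩
  exact h0 u hu

lemma keyK (G R J B : SL2) (D : Set PSL2)
    (hD : D = ((QuotientGroup.mk G : PSL2) * ·) '' rightCrooked (lineB B))
    (h : (fun x : PSL2 => (QuotientGroup.mk R : PSL2) * x * (QuotientGroup.mk J : PSL2)⁻¹) '' D = D ∨
      Disjoint ((fun x : PSL2 => (QuotientGroup.mk R : PSL2) * x * (QuotientGroup.mk J : PSL2)⁻¹) '' D) D)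
    (s : ℝ) : dist (G • B • E s) (R • G • B • E s) ≤ dist (B • E s) (J • B • E s) := by
  set x := B • E s with hx
  set z := G⁻¹ • R • G • x with hz
  have hGz : G • z = R • G • x := by rw [hz, smul_inv_smul]
  rw [← hGz, dist_smul]
  -- membership
  have memT : ∀ A : SL2, A • J • x = z → (QuotientGroup.mk (G * A) : PSL2) ∈
      (fun x : PSL2 => (QuotientGroup.mk R : PSL2) * x * (QuotientGroup.mk J : PSL2)⁻¹) '' D := by
    intro A hA
    refine ⟨QuotientGroup.mk (R⁻¹ * (G * A) * J), ?_, ?_⟩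
    · rw [hD]
      refine ⟨QuotientGroup.mk (G⁻¹ * (R⁻¹ * (G * A) * J)), ?_, ?_⟩
      · refine crooked_of_fix _ _ x ⟨s, rfl⟩ ?_
        rw [psl_mk]
        simp only [mul_smul]
        rw [hA, hGz, inv_smul_smul, inv_smul_smul]
      · change ((G * (G⁻¹ * (R⁻¹ * (G * A) * J)) : SL2) : PSL2) = _
        congr 1; group
    · change ((R * (R⁻¹ * (G * A) * J) * J⁻¹ : SL2) : PSL2) = _
      congr 1; group
  have memD : ∀ A : SL2, (QuotientGroup.mk A : PSL2) ∈ rightCrooked (lineB B) → (QuotientGroup.mk (G * A) : PSL2) ∈ D := by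
    intro A hA
    rw [hD]
    exact ⟨_, hA, rfl⟩
  rcases h with h | h
  · have : J • x = z := by
      apply lemN B
      intro A hA
      have h1 := memT A hA
      rw [h, hD] at h1
      obtain ⟨k, hk, hk2⟩ := h1
      have : k = QuotientGroup.mk A := by
        change (QuotientGroup.mk G : PSL2) * k = (QuotientGroup.mk G : PSL2) * QuotientGroup.mk A at hk2
        exact mul_left_cancel hk2
      rwa [← this]
    rw [this]
  · by_contra hlt
    push Not at hlt
    have hno : ∀ A : SL2, A • J • x = z → (QuotientGroup.mk A : PSL2) ∈ rightCrooked (lineB B) → False := by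
      intro A h1 h2
      exact Set.disjoint_left.mp h (memT A h1) (memD A h2)
    have hpos := pos_of_never_zero (fun t => dist (B • E t) z - dist (B • E t) (J • x)) ?_ ?_ s (by
      simpa [hx] using hlt)
    · have him : (B⁻¹ • z).im ≤ (B⁻¹ • J • x).im := by
        apply lim_a
        intro t
        have h3 := hpos t
        have e : ∀ y : ℍ, dist (B⁻¹ • y) (E t) = dist (B • E t) y := by
          intro y
          rw [← dist_smul B (B⁻¹ • y) (E t), smul_inv_smul, dist_comm]
        rw [e, e]
        linarith
      set P := UpperHalfPlane.toSL2R (B⁻¹ • z) with hP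
      set Q := UpperHalfPlane.toSL2R (B⁻¹ • J • x) with hQ
      obtain ⟨p1, p2, p3⟩ := toSL_entries (B⁻¹ • z)
      obtain ⟨q1, q2, q3⟩ := toSL_entries (B⁻¹ • J • x)
      rw [← hP] at p1 p2 p3
      rw [← hQ] at q1 q2 q3
      have e1 : B⁻¹ * (B * (P * Q⁻¹) * B⁻¹) * B = P * Q⁻¹ := by group
      refine hno (B * (P * Q⁻¹) * B⁻¹) ?_ ?_
      · simp only [mul_smul]
        rw [hQ, toSL_inv, toSL_I, smul_inv_smul]
      · apply crooked_of_nonattr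
        · rw [e1, sl_mul, p1, sl_inv10, q1]; simp
        · rw [e1, sl_mul, sl_inv10, q1, sl_inv00]
          have dq := sl_det Q
          rw [q1, mul_zero, sub_zero] at dq
          have q11 : 0 < Q 1 1 := by
            by_contra hh; push Not at hh
            nlinarith
          have hle : P 0 0 ≤ Q 0 0 := by rw [p3, q3]; exact Real.sqrt_le_sqrt him
          rw [neg_zero, mul_zero, add_zero, abs_of_pos (mul_pos p2 q11)]
          exact (mul_le_mul_of_nonneg_right hle q11.le).trans_eq dq
    · have : Continuous fun t => B • E t := ((isometry_smul ℍ B).comp E_isom).continuous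
      fun_prop
    · intro t ht
      obtain ⟨A, h1, h2⟩ := two_point (B • E t) (J • x) (B • E t) z (by linarith)
      refine hno A h2 ?_
      refine crooked_of_fix _ _ (B • E t) ⟨t, rfl⟩ ?_
      rw [psl_mk, h1]


lemma disp (A : SL2) (z : ℍ) : 4 * z.im ^ 2 * Real.sinh (dist z (A • z) / 2) ^ 2 =
    (A 0 0 * z.re + A 0 1 - A 1 0 * (z.re ^ 2 - z.im ^ 2) - A 1 1 * z.re) ^ 2 +
    (A 0 0 * z.im - A 1 0 * (2 * z.re * z.im) - A 1 1 * z.im) ^ 2 := by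
  obtain ⟨w, hw⟩ : ∃ w, w = A • z := ⟨_, rfl⟩
  have h := (sl_smul_iff' A z w).mp hw.symm
  have him := sl_im A z
  rw [← hw] at him ⊢
  rw [UpperHalfPlane.sinh_half_dist]
  have hz := z.im_pos
  have hwp := w.im_pos
  have hd : dist (z : ℂ) (w : ℂ) ^ 2 = (z.re - w.re) ^ 2 + (z.im - w.im) ^ 2 := by
    rw [Complex.dist_eq, ← Complex.normSq_eq_norm_sq, Complex.normSq_apply]
    simp; ring
  have hq : 0 < (A 1 0 * z.re + A 1 1) ^ 2 + (A 1 0 * z.im) ^ 2 := by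
    by_contra hh
    have h0 : (A 1 0 * z.re + A 1 1) ^ 2 + (A 1 0 * z.im) ^ 2 = 0 :=
      le_antisymm (not_lt.mp hh) (by positivity)
    rw [h0, div_zero] at him
    linarith
  rw [div_pow, mul_pow, Real.sq_sqrt (by positivity), hd]
  obtain ⟨h1, h2⟩ := h
  have e1 : A 0 0 * z.re + A 0 1 - A 1 0 * (z.re ^ 2 - z.im ^ 2) - A 1 1 * z.re =
     (w.re - z.re) * (A 1 0 * z.re + A 1 1) - (w.im - z.im) * (A 1 0 * z.im) := by
    linear_combination h1
  have e2 : A 0 0 * z.im - A 1 0 * (2 * z.re * z.im) - A 1 1 * z.im =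
     (w.re - z.re) * (A 1 0 * z.im) + (w.im - z.im) * (A 1 0 * z.re + A 1 1) := by
    linear_combination h2
  rw [e1, e2]
  have e3 : z.im = w.im * ((A 1 0 * z.re + A 1 1) ^ 2 + (A 1 0 * z.im) ^ 2) := by
    rw [him, div_mul_cancel₀ _ hq.ne']
  have e4 : 4 * z.im ^ 2 * (((z.re - w.re) ^ 2 + (z.im - w.im) ^ 2) / (2 ^ 2 * (z.im * w.im))) =
      ((z.re - w.re) ^ 2 + (z.im - w.im) ^ 2) * (z.im / w.im) := by
    field_simp; ring
  have e5 : z.im / w.im = (A 1 0 * z.re + A 1 1) ^ 2 + (A 1 0 * z.im) ^ 2 := by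
    rw [div_eq_iff hwp.ne']; linarith
  rw [e4, e5]
  ring

lemma exists_fix (R : SL2) (h : (R 0 0 + R 1 1) ^ 2 < 4) : ∃ c : ℍ, R • c = c := by
  have hd := sl_det R
  have hc : R 1 0 ≠ 0 := by
    intro hc
    rw [hc] at hd
    nlinarith [sq_nonneg (R 0 0 - R 1 1)]
  have hs : 0 < √(4 - (R 0 0 + R 1 1) ^ 2) := Real.sqrt_pos.mpr (by linarith)
  have hs2 : √(4 - (R 0 0 + R 1 1) ^ 2) ^ 2 = 4 - (R 0 0 + R 1 1) ^ 2 := Real.sq_sqrt (by linarith)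
  set σ := √(4 - (R 0 0 + R 1 1) ^ 2)
  have hca : 0 < |R 1 0| := abs_pos.mpr hc
  refine ⟨⟨⟨(R 0 0 - R 1 1) / (2 * R 1 0), σ / (2 * |R 1 0|)⟩, by simp only; positivity⟩, ?_⟩
  rw [sl_smul_iff']
  change R 0 0 * ((R 0 0 - R 1 1) / (2 * R 1 0)) + R 0 1 = ((R 0 0 - R 1 1) / (2 * R 1 0)) * (R 1 0 * ((R 0 0 - R 1 1) / (2 * R 1 0)) + R 1 1) - (σ / (2 * |R 1 0|)) * (R 1 0 * (σ / (2 * |R 1 0|))) ∧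
    R 0 0 * (σ / (2 * |R 1 0|)) = ((R 0 0 - R 1 1) / (2 * R 1 0)) * (R 1 0 * (σ / (2 * |R 1 0|))) + (σ / (2 * |R 1 0|)) * (R 1 0 * ((R 0 0 - R 1 1) / (2 * R 1 0)) + R 1 1)
  constructor
  · have : (σ / (2 * |R 1 0|)) * (R 1 0 * (σ / (2 * |R 1 0|))) = (4 - (R 0 0 + R 1 1) ^ 2) / (4 * R 1 0) := by
      rw [← hs2]
      have : |R 1 0| ^ 2 = R 1 0 ^ 2 := sq_abs _
      rw [show (σ / (2 * |R 1 0|)) * (R 1 0 * (σ / (2 * |R 1 0|))) = R 1 0 * σ ^ 2 / (4 * |R 1 0| ^ 2) by field_simp; norm_num, this]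
      field_simp
    rw [this]
    field_simp
    linear_combination (-16 : ℝ) * hd
  · field_simp
    ring

lemma Rot_comm (φ ψ : ℝ) : Rot φ * Rot ψ = Rot ψ * Rot φ := by
  ext i k
  fin_cases i <;> fin_cases k <;> simp [sl_mul, Rot00, Rot01, Rot10, Rot11] <;> ring

lemma rot_disp (φ : ℝ) (w : ℍ) : Real.sinh (dist w (Rot φ • w) / 2) ^ 2 =
    (Real.sin φ * Real.sinh (dist UpperHalfPlane.I w)) ^ 2 := by
  obtain ⟨ψ, s, hs, hw⟩ := to_axis w
  have h1 : dist w (Rot φ • w) = dist (E s) (Rot φ • E s) := by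
    rw [← hw, ← dist_smul (Rot ψ) w, ← mul_smul, ← mul_smul, Rot_comm]
  have h2 : dist UpperHalfPlane.I w = s := by
    rw [← dist_smul (Rot ψ), hw, Rot_I, ← E_zero, E_dist]
    simp [abs_of_nonneg hs]
  rw [h1, h2]
  have h3 := disp (Rot φ) (E s)
  simp only [E_re, E_im, Rot00, Rot01, Rot10, Rot11] at h3
  have h4 : Real.sinh s = (Real.exp s - (Real.exp s)⁻¹) / 2 := by rw [Real.sinh_eq, Real.exp_neg]
  have h5 := Real.exp_pos s
  rw [h4]
  have h6 : 4 * Real.exp s ^ 2 * (Real.sin φ * ((Real.exp s - (Real.exp s)⁻¹) / 2)) ^ 2 =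
      (Real.sin φ * (Real.exp s ^ 2 - 1)) ^ 2 := by
    field_simp
    ring
  have h7 : (4 * Real.exp s ^ 2) ≠ 0 := by positivity
  apply mul_left_cancel₀ h7
  rw [h6, h3]
  ring

lemma ell_ineq (R : SL2) (S : ℝ) (hS : 0 ≤ S) (h : (R 0 0 + R 1 1) ^ 2 ≤ 4 - 4 * S ^ 2) (c : ℍ) (hc : R • c = c) (w : ℍ) :
    S * Real.sinh (dist c w) ≤ Real.sinh (dist w (R • w) / 2) := by
  set τ := UpperHalfPlane.toSL2R c
  have hfix : (τ⁻¹ * R * τ) • UpperHalfPlane.I = UpperHalfPlane.I := by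
    simp only [mul_smul]; rw [toSL_I, hc, toSL_inv]
  obtain ⟨φ, hφ⟩ := fix_I _ hfix
  have htr : R 0 0 + R 1 1 = 2 * Real.cos φ := by
    have h1 : (τ⁻¹ * R * τ) 0 0 + (τ⁻¹ * R * τ) 1 1 = 2 * Real.cos φ := by
      rw [hφ, Rot00, Rot11]; ring
    rw [← h1]
    simp only [sl_mul, sl_inv00, sl_inv01, sl_inv10, sl_inv11]
    have := sl_det τ
    linear_combination (-(R 0 0 + R 1 1)) * this
  have hR : R = τ * Rot φ * τ⁻¹ := by rw [← hφ]; group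
  have h1 : dist w (R • w) = dist (τ⁻¹ • w) (Rot φ • (τ⁻¹ • w)) := by
    rw [hR, ← dist_smul τ⁻¹ w]
    simp only [mul_smul, inv_smul_smul]
  have h2 : dist c w = dist UpperHalfPlane.I (τ⁻¹ • w) := by
    rw [← toSL_inv c, dist_smul]
  have h3 := rot_disp φ (τ⁻¹ • w)
  rw [← h1, ← h2] at h3
  rw [htr] at h
  have h4 : S ^ 2 ≤ Real.sin φ ^ 2 := by nlinarith [Real.sin_sq_add_cos_sq φ]
  apply le_of_sq_le_sq ?_ (Real.sinh_nonneg_iff.mpr (by positivity))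
  rw [h3, mul_pow, mul_pow]
  exact mul_le_mul_of_nonneg_right h4 (sq_nonneg _)

lemma phi_ut (J : SL2) (h : J 1 0 = 0) (x p : ℍ) :
    Real.sinh (dist x (J • x) / 2) ≤ Real.exp (dist x p) * Real.sinh (dist p (J • p) / 2) := by
  have hx := disp J x
  have hp := disp J p
  rw [h] at hx hp
  have yx := x.im_pos
  have yp := p.im_pos
  have sx : 0 ≤ Real.sinh (dist x (J • x) / 2) := Real.sinh_nonneg_iff.mpr (by positivity)
  have sp : 0 ≤ Real.sinh (dist p (J • p) / 2) := Real.sinh_nonneg_iff.mpr (by positivity)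
  set Sx := Real.sinh (dist x (J • x) / 2)
  set Sp := Real.sinh (dist p (J • p) / 2)
  set e := Real.exp (dist x p) with he
  have he0 : 0 < e := Real.exp_pos _
  have hy : p.im ≤ x.im * e := by
    have := UpperHalfPlane.im_le_im_mul_exp_dist p x
    rwa [dist_comm p x] at this
  apply le_of_sq_le_sq ?_ (by positivity)
  obtain ⟨α, hα⟩ : ∃ α, α = J 0 0 - J 1 1 := ⟨_, rfl⟩
  obtain ⟨β, hβ⟩ : ∃ β, β = J 0 1 := ⟨_, rfl⟩
  have hx' : 4 * x.im ^ 2 * Sx ^ 2 = (α * x.re + β) ^ 2 + (α * x.im) ^ 2 := by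
    rw [hx, hα, hβ]; ring
  have hp' : 4 * p.im ^ 2 * Sp ^ 2 = (α * p.re + β) ^ 2 + (α * p.im) ^ 2 := by
    rw [hp, hα, hβ]; ring
  have hL : ((α * x.re + β) ^ 2 + (α * x.im) ^ 2) * p.im ≤ e * x.im * ((α * p.re + β) ^ 2 + (α * p.im) ^ 2) := by
    by_cases h0 : α = 0
    · rw [h0]; nlinarith [mul_le_mul_of_nonneg_left hy (sq_nonneg β)]
    · let M : SL2 := ⟨!![0, -1/α; α, β], by rw [Matrix.det_fin_two_of]; field_simp; ring⟩
      have m1 := sl_im M x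
      have m2 := sl_im M p
      have m3 := UpperHalfPlane.im_le_im_mul_exp_dist (M • p) (M • x)
      rw [dist_smul, dist_comm p x, ← he, m1, m2] at m3
      have M10 : M 1 0 = α := rfl
      have M11 : M 1 1 = β := rfl
      rw [M10, M11] at m3
      have d1 : 0 < (α * x.re + β) ^ 2 + (α * x.im) ^ 2 := by positivity
      have d2 : 0 < (α * p.re + β) ^ 2 + (α * p.im) ^ 2 := by positivity
      rw [div_mul_eq_mul_div, div_le_div_iff₀ d2 d1] at m3
      linarith
  have hk : 0 < 4 * x.im ^ 2 * p.im ^ 2 := by positivity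
  apply le_of_mul_le_mul_left ?_ hk
  calc 4 * x.im ^ 2 * p.im ^ 2 * Sx ^ 2 = p.im * (((α * x.re + β) ^ 2 + (α * x.im) ^ 2) * p.im) := by rw [← hx']; ring
    _ ≤ (x.im * e) * (e * x.im * ((α * p.re + β) ^ 2 + (α * p.im) ^ 2)) :=
        mul_le_mul hy hL (by positivity) (by positivity)
    _ = 4 * x.im ^ 2 * p.im ^ 2 * (e * Sp) ^ 2 := by rw [← hp']; ring

lemma phi_gen (J : SL2) (h : 4 ≤ (J 0 0 + J 1 1) ^ 2) (x p : ℍ) :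
    Real.sinh (dist x (J • x) / 2) ≤ Real.exp (dist x p) * Real.sinh (dist p (J • p) / 2) := by
  by_cases hc : J 1 0 = 0
  · exact phi_ut J hc x p
  · have hd := sl_det J
    have hs : √((J 0 0 + J 1 1) ^ 2 - 4) ^ 2 = (J 0 0 + J 1 1) ^ 2 - 4 := Real.sq_sqrt (by linarith)
    set σ := √((J 0 0 + J 1 1) ^ 2 - 4)
    obtain ⟨l, hl⟩ : ∃ l, l = (J 0 0 + J 1 1 + σ) / 2 := ⟨_, rfl⟩
    have hl2 : l ^ 2 - (J 0 0 + J 1 1) * l + 1 = 0 := by rw [hl]; linear_combination hs / 4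
    let B : SL2 := ⟨!![l - J 1 1, -1 / J 1 0; J 1 0, 0], by rw [Matrix.det_fin_two_of]; field_simp; ring⟩
    have B00 : B 0 0 = l - J 1 1 := rfl
    have B10 : B 1 0 = J 1 0 := rfl
    have hut : (B⁻¹ * J * B) 1 0 = 0 := by
      simp only [sl_mul, sl_inv00, sl_inv01, sl_inv10, sl_inv11, B00, B10]
      linear_combination (- J 1 0) * hl2 + (- J 1 0) * hd + 2 * J 1 0 * (hl2 + hd)
    have := phi_ut _ hut (B⁻¹ • x) (B⁻¹ • p)
    have e : ∀ y : ℍ, dist (B⁻¹ • y) ((B⁻¹ * J * B) • B⁻¹ • y) = dist y (J • y) := by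
      intro y
      rw [mul_smul, mul_smul, smul_inv_smul, dist_smul]
    rwa [e, e, dist_smul] at this


lemma Rot_periodic : Function.Periodic Rot (2 * Real.pi) := by
  intro t
  ext i k
  fin_cases i <;> fin_cases k <;> simp [Rot00, Rot01, Rot10, Rot11]

def param (q c : ℍ) (t : ℝ) : PSL2 :=
  QuotientGroup.mk (UpperHalfPlane.toSL2R c * Rot t * (UpperHalfPlane.toSL2R q)⁻¹)

lemma param_mem (q c : ℍ) (t : ℝ) : pslSMul (param q c t) q = c := by
  unfold param
  rw [psl_mk, mul_smul, mul_smul, toSL_inv, Rot_I, toSL_I]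

lemma param_surj (q c : ℍ) (h : PSL2) (hh : pslSMul h q = c) : ∃ t, h = param q c t := by
  obtain ⟨A, rfl⟩ := QuotientGroup.mk_surjective h
  rw [psl_mk] at hh
  have : ((UpperHalfPlane.toSL2R c)⁻¹ * A * UpperHalfPlane.toSL2R q) • UpperHalfPlane.I = UpperHalfPlane.I := by
    rw [mul_smul, mul_smul, toSL_I, hh, toSL_inv]
  obtain ⟨φ, hφ⟩ := fix_I _ this
  refine ⟨φ, ?_⟩
  unfold param
  rw [← hφ]
  congr 1
  group

lemma cont_mk : Continuous (QuotientGroup.mk : SL2 → PSL2) := QuotientGroup.continuous_mk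

lemma cont_param (q : ℍ) : Continuous (fun x : ℍ × ℝ => param q x.1 x.2) := by
  unfold param
  apply cont_mk.comp
  exact ((cont_toSL.comp continuous_fst).mul (continuous_Rot.comp continuous_snd)).mul continuous_const

lemma cont_param1 (q c : ℍ) : Continuous (param q c) := by
  unfold param
  apply cont_mk.comp
  exact (continuous_const.mul continuous_Rot).mul continuous_const

lemma compact_stab (q c : ℍ) : IsCompact {h : PSL2 | pslSMul h q = c} := by
  have : {h : PSL2 | pslSMul h q = c} = Set.range (param q c) := by
    ext h
    constructor
    · intro hh
      obtain ⟨t, ht⟩ := param_surj q c h hh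
      exact ⟨t, ht.symm⟩
    · rintro ⟨t, rfl⟩
      exact param_mem q c t
  rw [this]
  refine Function.Periodic.compact_of_continuous (c := 2 * Real.pi) ?_ (by positivity) ?_
  · intro t
    unfold param
    rw [Rot_periodic t]
  · exact cont_param1 q c

lemma cont_psl (p : ℍ) : Continuous (fun h : PSL2 => pslSMul h p) := by
  rw [(QuotientGroup.isQuotientMap_mk (Subgroup.center SL2)).continuous_iff]
  have : (fun h : PSL2 => pslSMul h p) ∘ (QuotientGroup.mk : SL2 → PSL2) = fun A => A • p := by
    ext1 A
    exact psl_mk A p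
  rw [this]
  exact continuous_id.smul continuous_const

def Vset (p c : ℍ) : Set PSL2 := {h | dist (pslSMul h p) c < 1 / 10}

lemma V_open (p c : ℍ) : IsOpen (Vset p c) := 
  isOpen_lt ((cont_psl p).dist continuous_const) continuous_const

lemma V_conn (p c : ℍ) : IsPreconnected (Vset p c) := by
  have : Vset p c = (fun x : ℍ × ℝ => param p x.1 x.2) '' (Metric.ball c (1/10) ×ˢ Set.univ) := by
    ext h
    constructor
    · intro hh
      obtain ⟨t, ht⟩ := param_surj p _ h rfl
      exact ⟨(pslSMul h p, t), ⟨hh, trivial⟩, ht.symm⟩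
    · rintro ⟨⟨q, t⟩, ⟨h1, -⟩, rfl⟩
      change dist (pslSMul (param p q t) p) c < 1 / 10
      rw [param_mem]
      exact h1
  rw [this]
  refine IsPreconnected.image ?_ _ (cont_param p).continuousOn
  refine IsPreconnected.prod ?_ isPreconnected_univ
  have h1 : Topology.IsInducing ((↑) : ℍ → ℂ) := UpperHalfPlane.isEmbedding_coe.isInducing
  rw [← h1.isPreconnected_image, UpperHalfPlane.image_coe_ball]
  exact (convex_ball _ _).isPreconnected

lemma pd_fix {Γ : Type*} [Group Γ] [IsMulTorsionFree Γ] (j ρ : Γ →* PSL2) (hpd : ProperlyDisc j ρ) (γ : Γ) (q c : ℍ)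
    (hq : pslSMul (j γ) q = q) (hc : pslSMul (ρ γ) c = c) : γ = 1 := by
  by_contra hne
  have hinf := (infinite_powers (a := γ)).mpr (not_isOfFinOrder_of_isMulTorsionFree hne)
  apply hinf
  refine (hpd _ (compact_stab q c)).subset ?_
  rintro g ⟨n, rfl⟩
  have hpow : ∀ (f : Γ →* PSL2) (w : ℍ), pslSMul (f γ) w = w → ∀ n : ℕ, pslSMul (f (γ ^ n)) w = w := by
    intro f w hw n
    induction n with
    | zero => rw [pow_zero, map_one, psl_one]
    | succ k ih => rw [pow_succ, map_mul, psl_mul, hw, ih]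
  have hinv : pslSMul ((j (γ ^ n))⁻¹) q = q := by
    conv_lhs => rw [← hpow j q hq n]
    rw [← psl_mul, inv_mul_cancel, psl_one]
  refine ⟨_, ⟨param q c 0, param_mem q c 0, rfl⟩, ?_⟩
  change pslSMul (ρ (γ ^ n) * param q c 0 * (j (γ ^ n))⁻¹) q = c
  rw [psl_mul, psl_mul, hinv, param_mem, hpow ρ c hc]


lemma avoid_end (G A B : SL2) (p c : ℍ)
    (hb : ∀ s, dist c (G • B • E s) ≤ dist p (B • E s) - 1 / 2)
    (hV : dist (G • A • p) c < 1 / 10)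
    (h1 : (B⁻¹ * A * B) 1 0 = 0) (h2 : |(B⁻¹ * A * B) 0 0| ≤ 1) : False := by
  have h3 := lim_b (B⁻¹ • A • p) (B⁻¹ • p) ?_
  · set N := B⁻¹ * A * B with hN
    have e : B⁻¹ • A • p = N • (B⁻¹ • p) := by
      rw [hN]; simp only [mul_smul, smul_inv_smul]
    have d := sl_det N
    have him := sl_im N (B⁻¹ • p)
    rw [h1] at d him
    rw [e, him] at h3
    have hw := (B⁻¹ • p).im_pos
    have h4 : 1 ≤ N 1 1 ^ 2 := by
      have h5 : N 0 0 ^ 2 ≤ 1 := by rw [← sq_abs]; exact pow_le_one₀ (abs_nonneg _) h2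
      have h6 : N 0 0 ^ 2 * N 1 1 ^ 2 = 1 := by
        have : N 0 0 * N 1 1 = 1 := by linarith
        rw [← mul_pow, this, one_pow]
      nlinarith [sq_nonneg (N 1 1)]
    rw [lt_div_iff₀ (by nlinarith)] at h3
    nlinarith
  · intro s
    have e : ∀ y : ℍ, dist (B⁻¹ • y) (E s) = dist y (B • E s) := by
      intro y
      rw [← dist_smul B (B⁻¹ • y) (E s), smul_inv_smul]
    rw [e, e]
    have := hb s
    have h4 := dist_triangle (G • A • p) c (G • B • E s)
    rw [dist_smul G] at h4
    linarith

lemma avoid_bounds (G R J B : SL2) (D : Set PSL2)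
    (hD : D = ((QuotientGroup.mk G : PSL2) * ·) '' rightCrooked (lineB B))
    (h : (fun x : PSL2 => (QuotientGroup.mk R : PSL2) * x * (QuotientGroup.mk J : PSL2)⁻¹) '' D = D ∨
      Disjoint ((fun x : PSL2 => (QuotientGroup.mk R : PSL2) * x * (QuotientGroup.mk J : PSL2)⁻¹) '' D) D)
    (S : ℝ) (hS : 0 < S) (hR : (R 0 0 + R 1 1) ^ 2 ≤ 4 - 4 * S ^ 2) (c : ℍ) (hc : R • c = c)
    (hJ : 4 ≤ (J 0 0 + J 1 1) ^ 2) (p : ℍ) (hp : Real.sinh (dist p (J • p) / 2) < S / 20) (s : ℝ) :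
    dist c (G • B • E s) ≤ dist p (B • E s) - 1 / 2 := by
  have bound : ∀ s, Real.sinh (dist c (G • B • E s)) < Real.exp (dist p (B • E s)) / 20 := by
    intro s
    have h1 := ell_ineq R S hS.le hR c hc (G • B • E s)
    have h2 := keyK G R J B D hD h s
    have h3 := phi_gen J hJ (B • E s) p
    have h4 : Real.sinh (dist (G • B • E s) (R • G • B • E s) / 2) ≤
        Real.sinh (dist (B • E s) (J • B • E s) / 2) := Real.sinh_le_sinh.mpr (by linarith)
    have h5 := mul_lt_mul_of_pos_left hp (Real.exp_pos (dist (B • E s) p))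
    rw [dist_comm p]
    have h6 : S * Real.sinh (dist c (G • B • E s)) < S * (Real.exp (dist (B • E s) p) / 20) := by
      calc _ ≤ _ := h1
        _ ≤ _ := h4
        _ ≤ _ := h3
        _ < _ := h5
        _ = _ := by ring
    exact lt_of_mul_lt_mul_left h6 hS.le
  have lin : ∀ s, dist c (G • B • E s) < Real.exp (dist p (B • E s)) / 20 := fun s =>
    (Real.self_le_sinh_iff.mpr dist_nonneg).trans_lt (bound s)
  set a := dist p (B • E s) with ha
  have ha1 : 1 ≤ a := by
    by_contra hlt
    push Not at hlt
    have l0 := lin s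
    have l1 := lin (s + 1)
    have e1 : dist (B • E s) (B • E (s + 1)) = 1 := by rw [dist_smul, E_dist]; simp
    have e2 : dist (G • B • E s) (G • B • E (s + 1)) = 1 := by rw [dist_smul, e1]
    have t1 := dist_triangle p (B • E s) (B • E (s + 1))
    have t2 := dist_triangle (G • B • E s) c (G • B • E (s + 1))
    rw [dist_comm (G • B • E s) c, e2] at t2
    have x1 : Real.exp a ≤ Real.exp 1 := Real.exp_le_exp.mpr hlt.le
    have x2 : Real.exp (dist p (B • E (s + 1))) ≤ Real.exp 1 * Real.exp 1 := by
      rw [← Real.exp_add]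
      exact Real.exp_le_exp.mpr (by linarith)
    have x3 := Real.exp_one_lt_d9
    have x4 := Real.exp_pos 1
    nlinarith
  by_contra hlt
  push Not at hlt
  have h1 : Real.sinh (a - 1 / 2) ≤ Real.sinh (dist c (G • B • E s)) := Real.sinh_le_sinh.mpr hlt.le
  have h2 := bound s
  rw [← ha] at h2
  rw [Real.sinh_eq] at h1
  have e1 : Real.exp (a - 1 / 2) = Real.exp a * Real.exp (-(1 / 2)) := by rw [← Real.exp_add]; congr 1
  have e2 : Real.exp (-(a - 1 / 2)) ≤ Real.exp (-(1 / 2)) := Real.exp_le_exp.mpr (by linarith)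
  have e3 : 1 / 2 ≤ Real.exp (-(1 / 2 : ℝ)) := by
    have := Real.add_one_le_exp (-(1 / 2 : ℝ)); linarith
  have e4 : 2 ≤ Real.exp a := by
    have := Real.add_one_le_exp a; linarith
  rw [e1] at h1
  nlinarith

lemma avoid (G R J B : SL2) (D : Set PSL2)
    (hD : D = ((QuotientGroup.mk G : PSL2) * ·) '' rightCrooked (lineB B))
    (h : (fun x : PSL2 => (QuotientGroup.mk R : PSL2) * x * (QuotientGroup.mk J : PSL2)⁻¹) '' D = D ∨
      Disjoint ((fun x : PSL2 => (QuotientGroup.mk R : PSL2) * x * (QuotientGroup.mk J : PSL2)⁻¹) '' D) D)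
    (S : ℝ) (hS : 0 < S) (hR : (R 0 0 + R 1 1) ^ 2 ≤ 4 - 4 * S ^ 2) (c : ℍ) (hc : R • c = c)
    (hJ : 4 ≤ (J 0 0 + J 1 1) ^ 2) (p : ℍ) (hp : Real.sinh (dist p (J • p) / 2) < S / 20) :
    Disjoint (Vset p c) D := by
  have hb := avoid_bounds G R J B D hD h S hS hR c hc hJ p hp
  rw [Set.disjoint_left]
  intro k hV hk
  rw [hD] at hk
  obtain ⟨k', hk', rfl⟩ := hk
  obtain ⟨A, rfl⟩ := QuotientGroup.mk_surjective k'
  have hV' : dist (G • A • p) c < 1 / 10 := by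
    have : dist (pslSMul ((QuotientGroup.mk G : PSL2) * QuotientGroup.mk A) p) c < 1 / 10 := hV
    rwa [psl_mul, psl_mk, psl_mk] at this
  rcases crooked_cases A B hk' with ⟨s, hs⟩ | ⟨h1, h2⟩ | ⟨h1, h2⟩
  · have := hb s
    have h4 := dist_triangle (G • A • p) c (G • B • E s)
    have h5 : dist (G • A • p) (G • B • E s) = dist p (B • E s) := by
      rw [dist_smul]
      conv_lhs => rw [← hs]
      rw [dist_smul]
    linarith
  · exact avoid_end G A B p c hb hV' h1 h2
  · refine avoid_end G A (B * W) p c ?_ hV' h1 h2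
    intro s
    rw [mul_smul, W_E]
    exact hb (-s)


/-- The configuration leading to a contradiction. -/
def Good {Γ : Type*} [Group Γ] (j ρ : Γ →* PSL2) (S : ℝ) (γ : Γ) (p c : ℍ) : Prop :=
  ∃ R J : SL2, (QuotientGroup.mk R : PSL2) = ρ γ ∧ (QuotientGroup.mk J : PSL2) = j γ ∧
    (R 0 0 + R 1 1) ^ 2 ≤ 4 - 4 * S ^ 2 ∧ R • c = c ∧ 4 ≤ (J 0 0 + J 1 1) ^ 2 ∧
    Real.sinh (dist p (J • p) / 2) < S / 20

lemma conj_tr (M A : SL2) : (M⁻¹ * A * M) 0 0 + (M⁻¹ * A * M) 1 1 = A 0 0 + A 1 1 := by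
  simp only [sl_mul, sl_inv00, sl_inv01, sl_inv10, sl_inv11]
  have := sl_det M
  linear_combination (A 0 0 + A 1 1) * this

lemma good_conj {Γ : Type*} [Group Γ] (j ρ : Γ →* PSL2) (S : ℝ) (γ : Γ) (p c : ℍ)
    (h : Good j ρ S γ p c) (d : Γ) :
    Good j ρ S (d⁻¹ * γ * d) (pslSMul (j d⁻¹) p) (pslSMul (ρ d⁻¹) c) := by
  obtain ⟨R, J, h1, h2, h3, h4, h5, h6⟩ := h
  obtain ⟨M, hM⟩ := QuotientGroup.mk_surjective (ρ d)
  obtain ⟨N, hN⟩ := QuotientGroup.mk_surjective (j d)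
  have eM : (QuotientGroup.mk M⁻¹ : PSL2) = ρ d⁻¹ := by rw [map_inv, ← hM]; rfl
  have eN : (QuotientGroup.mk N⁻¹ : PSL2) = j d⁻¹ := by rw [map_inv, ← hN]; rfl
  refine ⟨M⁻¹ * R * M, N⁻¹ * J * N, ?_, ?_, ?_, ?_, ?_, ?_⟩
  · rw [map_mul, map_mul, ← eM, ← hM, ← h1]; rfl
  · rw [map_mul, map_mul, ← eN, ← hN, ← h2]; rfl
  · rwa [conj_tr]
  · rw [← eM, psl_mk]; simp only [mul_smul, smul_inv_smul]; rw [h4]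
  · rwa [conj_tr]
  · rw [← eN, psl_mk]; simp only [mul_smul, smul_inv_smul]; rwa [dist_smul]

lemma V_trans {Γ : Type*} [Group Γ] (j ρ : Γ →* PSL2) (d : Γ) (p c : ℍ) (x : PSL2) :
    ρ d * x * (j d)⁻¹ ∈ Vset (pslSMul (j d) p) (pslSMul (ρ d) c) ↔ x ∈ Vset p c := by
  unfold Vset
  simp only [Set.mem_ofPred_eq]
  rw [psl_mul, ← psl_mul (j d)⁻¹, inv_mul_cancel, psl_one, psl_mul, psl_dist]

lemma V_trans' {Γ : Type*} [Group Γ] (j ρ : Γ →* PSL2) (d : Γ) (p c : ℍ) (x : PSL2) :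
    ρ d * x * (j d)⁻¹ ∈ Vset p c ↔ x ∈ Vset (pslSMul (j d⁻¹) p) (pslSMul (ρ d⁻¹) c) := by
  rw [← V_trans j ρ d _ _ x, ← psl_mul, ← psl_mul, ← map_mul, ← map_mul, mul_inv_cancel, map_one, map_one,
    psl_one, psl_one]

lemma act_one {Γ : Type*} [Group Γ] (j ρ : Γ →* PSL2) (X : Set PSL2) : actImg j ρ 1 X = X := by
  unfold actImg; simp

lemma good_avoid {Γ : Type*} [Group Γ] (j ρ : Γ →* PSL2) (S : ℝ) (hS : 0 < S) (γ : Γ) (p c : ℍ)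
    (h : Good j ρ S γ p c) (D : Set PSL2) (hD : IsRightCrookedPlane D)
    (hdis : actImg j ρ γ D = D ∨ Disjoint (actImg j ρ γ D) D) : Disjoint (Vset p c) D := by
  obtain ⟨R, J, h1, h2, h3, h4, h5, h6⟩ := h
  obtain ⟨g, l, hl, hDe⟩ := hD
  obtain ⟨B, rfl⟩ := line_form l hl
  obtain ⟨G, rfl⟩ := QuotientGroup.mk_surjective g
  unfold actImg at hdis
  rw [← h1, ← h2] at hdis
  exact avoid G R J B D hDe hdis S hS h3 c h4 h5 p h6

lemma good_false {Γ : Type*} [Group Γ] (j ρ : Γ →* PSL2) (hfd : AdmitsRightCrookedFD j ρ)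
    (S : ℝ) (hS : 0 < S) (hS1 : S ≤ 1) (γ : Γ) (hγ : γ ≠ 1) (p c : ℍ) (h : Good j ρ S γ p c) : False := by
  obtain ⟨m, D, hD, hdis, x0, hx0, hclosed, hcov, hpw⟩ := hfd
  set Ω := (⋃ (γ : Γ) (i : Fin m), actImg j ρ γ (D i))ᶜ with hΩ
  -- avoidance
  have hav : ∀ (γ : Γ) (p c : ℍ), Good j ρ S γ p c → Vset p c ⊆ Ω := by
    intro γ p c h y hy hy2
    simp only [Set.mem_iUnion] at hy2
    obtain ⟨d, i, x, hx, rfl⟩ := hy2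
    have hy' := (V_trans' j ρ d p c x).mp hy
    have hg := good_conj j ρ S γ p c h d
    have hdd := hdis (d⁻¹ * γ * d) 1 i i
    rw [act_one] at hdd
    exact Set.disjoint_left.mp (good_avoid j ρ S hS _ _ _ hg (D i) (hD i) hdd) hy' hx
  -- move to the fundamental domain
  have h0 : param p c 0 ∈ (⋃ γ : Γ, actImg j ρ γ (closure (connectedComponentIn Ω x0))) := by
    rw [hcov]; trivial
  simp only [Set.mem_iUnion] at h0
  obtain ⟨d, x, hx, hxe⟩ := h0
  have hxe' : ρ d * x * (j d)⁻¹ = param p c 0 := hxe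
  have hmem : param p c 0 ∈ Vset p c := by
    change dist (pslSMul (param p c 0) p) c < 1 / 10
    rw [param_mem, dist_self]; norm_num
  rw [← hxe', V_trans'] at hmem
  have hg := good_conj j ρ S γ p c h d
  have hγ' : d⁻¹ * γ * d ≠ 1 := by
    intro hh
    apply hγ
    have : γ = d * (d⁻¹ * γ * d) * d⁻¹ := by group
    rw [this, hh]; group
  generalize pslSMul (j d⁻¹) p = p' at *
  generalize pslSMul (ρ d⁻¹) c = c' at *
  generalize d⁻¹ * γ * d = γ' at *
  have hsub := hav _ _ _ hg
  obtain ⟨y, hyV, hyU⟩ := mem_closure_iff.mp hx _ (V_open p' c') hmem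
  have hVU : Vset p' c' ⊆ connectedComponentIn Ω x0 := by
    rw [connectedComponentIn_eq hyU]
    exact (V_conn p' c').subset_connectedComponentIn hyV hsub
  have hVR : Vset p' c' ⊆ closure (connectedComponentIn Ω x0) := hVU.trans subset_closure
  have hVR2 : Vset (pslSMul (j γ') p') (pslSMul (ρ γ') c') ⊆ actImg j ρ γ' (closure (connectedComponentIn Ω x0)) := by
    intro y hy
    have e : y = ρ γ' * ((ρ γ')⁻¹ * y * j γ') * (j γ')⁻¹ := by group
    refine ⟨(ρ γ')⁻¹ * y * j γ', hVR ?_, e.symm⟩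
    rw [e, V_trans] at hy
    exact hy
  have hpw' := hpw hγ'
  simp only [act_one] at hpw'
  have hq : param p' c' 0 ∈ Vset p' c' := by
    change dist (pslSMul (param p' c' 0) p') c' < 1 / 10
    rw [param_mem, dist_self]; norm_num
  refine Set.disjoint_left.mp hpw' (interior_maximal hVR2 (V_open _ _)
    ((V_trans j ρ γ' p' c' _).mpr hq)) ?_
  · refine interior_maximal hVR (V_open _ _) ?_
    obtain ⟨R, J, h1, h2, h3, h4, h5, h6⟩ := hg
    change dist (pslSMul (ρ γ' * param p' c' 0 * (j γ')⁻¹) p') c' < 1 / 10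
    have ec : c' = pslSMul (ρ γ' * param p' c' 0) p' := by
      rw [psl_mul, param_mem, ← h1, psl_mk, h4]
    rw [psl_mul]
    generalize ρ γ' * param p' c' 0 = k at *
    rw [ec, psl_dist]
    have e2 : dist (pslSMul (j γ')⁻¹ p') p' = dist p' (J • p') := by
      rw [← psl_dist (j γ'), ← psl_mul, mul_inv_cancel, psl_one, ← h2, psl_mk]
    rw [e2]
    have := Real.self_le_sinh_iff.mpr (by positivity : 0 ≤ dist p' (J • p') / 2)
    linarith

theorem main_thm (r : ℕ) (hr : 1 ≤ r) (θ : ℝ) (hθ0 : 0 < θ) (hθπ : θ ≤ Real.pi) :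
    ∃ δ > 0, ∀ j ρ : FreeGroup (Fin r) →* PSL2,
      ProperlyDisc j ρ → AdmitsRightCrookedFD j ρ →
      ∀ γ : FreeGroup (Fin r),
        (∃ A : SL2, (QuotientGroup.mk A : PSL2) = ρ γ ∧
          |Matrix.trace (A : Matrix (Fin 2) (Fin 2) ℝ)| ≤ 2 * Real.cos (θ / 2)) →
        δ ≤ transLength (j γ) := by
  obtain ⟨S, hSe⟩ : ∃ S, S = Real.sin (θ / 2) := ⟨_, rfl⟩
  have hS : 0 < S := by
    rw [hSe]; exact Real.sin_pos_of_pos_of_lt_pi (by linarith) (by linarith)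
  have hS1 : S ≤ 1 := by rw [hSe]; exact Real.sin_le_one _
  refine ⟨2 * Real.arsinh (S / 20), by
    have := Real.arsinh_pos_iff.mpr (by positivity : 0 < S / 20); linarith, ?_⟩
  rintro j ρ hpd hfd γ ⟨R, hR, htr⟩
  rw [Matrix.trace_fin_two] at htr
  have hR2 : (R 0 0 + R 1 1) ^ 2 ≤ 4 - 4 * S ^ 2 := by
    have h1 : (R 0 0 + R 1 1) ^ 2 ≤ (2 * Real.cos (θ / 2)) ^ 2 := by
      rw [← sq_abs]; exact pow_le_pow_left₀ (abs_nonneg _) htr 2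
    have h2 := Real.sin_sq_add_cos_sq (θ / 2)
    rw [← hSe] at h2
    nlinarith
  obtain ⟨c, hc⟩ := exists_fix R (by nlinarith)
  have hγ : γ ≠ 1 := by
    intro h1
    rw [h1, map_one] at hR
    have hall : ∀ w : ℍ, w = c := by
      intro w
      have h2 := ell_ineq R S hS.le hR2 c hc w
      have h3 : R • w = w := by rw [← psl_mk, hR, psl_one]
      rw [h3, dist_self, zero_div, Real.sinh_zero] at h2
      have h4 : Real.sinh (dist c w) ≤ 0 := by
        by_contra hh; push Not at hh
        have := mul_pos hS hh; linarith
      have h5 := Real.sinh_nonpos_iff.mp h4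
      exact (dist_le_zero.mp h5).symm
    have h6 := E_dist 0 1
    rw [hall (E 0), hall (E 1)] at h6
    simp at h6
  obtain ⟨J, hJ⟩ := QuotientGroup.mk_surjective (j γ)
  have hJ4 : 4 ≤ (J 0 0 + J 1 1) ^ 2 := by
    by_contra hlt
    push Not at hlt
    obtain ⟨q, hq⟩ := exists_fix J hlt
    exact hγ (pd_fix j ρ hpd γ q c (by rw [← hJ, psl_mk, hq]) (by rw [← hR, psl_mk, hc]))
  unfold transLength
  apply le_ciInf
  intro p
  by_contra hlt
  push Not at hlt
  refine good_false j ρ hfd S hS hS1 γ hγ p c ⟨R, J, hR, hJ, hR2, hc, hJ4, ?_⟩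
  rw [← hJ, psl_mk] at hlt
  calc Real.sinh (dist p (J • p) / 2) < Real.sinh (Real.arsinh (S / 20)) :=
        Real.sinh_lt_sinh.mpr (by linarith)
    _ = S / 20 := Real.sinh_arsinh _

theorem stmt12 (r : ℕ) (hr : 1 ≤ r) (θ : ℝ) (hθ0 : 0 < θ) (hθπ : θ ≤ Real.pi) :
    ∃ δ > 0, ∀ j ρ : FreeGroup (Fin r) →* PSL2,
      ProperlyDisc j ρ → AdmitsRightCrookedFD j ρ →
      ∀ γ : FreeGroup (Fin r),
        (∃ A : SL2, (QuotientGroup.mk A : PSL2) = ρ γ ∧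
          |Matrix.trace (A : Matrix (Fin 2) (Fin 2) ℝ)| ≤ 2 * Real.cos (θ / 2)) →
        δ ≤ transLength (j γ) := by
  exact main_thm r hr θ hθ0 hθπ

end
end

section
/- Fix R > 1 and let ℓ = {z ∈ ℍ : |z| = 1/R}, a geodesic line of ℍ, transversely oriented with positive side {z ∈ ℍ : |z| < 1/R}. For h ∈ PSL(2,ℝ), the following are equivalent: (i) h is hyperbolic (some lift A ∈ SL(2,ℝ) has |tr A| > 2), and its attracting fixed point ξ₊ and repelling fixed point ξ₋ in ℝ ∪ {∞} (the two fixed points of its Möbius action on ℝ ∪ {∞}, where the eigenvalue of a lift at the attracting one has absolute value > 1 and at the repelling one absolute value < 1) satisfy either (ξ₊, ξ₋ ∈ ℝ with ξ₊·ξ₋ = 1/R² and |ξ₊| < 1/R) or (ξ₊ = 0 and ξ₋ = ∞) — geometrically, the translation axis of h is orthogonal to ℓ and h translates towards the positive side of ℓ; (ii) h admits a lift of the form [[α, −v/R],[vR, β]] ∈ SL(2,ℝ) (so αβ + v² = 1) with |α| < |β| and 2|v| < |α − β|. -/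
noncomputable section

open Filter Topology Pointwise
open scoped UpperHalfPlane

variable {Γ : Type*} [Group Γ]

theorem aux_abs_lt {p q : ℝ} (h : |p| < |q|) : 0 < (q - p) * (q + p) := by
  have := sq_lt_sq.mpr h
  nlinarith

theorem aux_lt_abs {p q : ℝ} (h : 0 < (q - p) * (q + p)) : |p| < |q| := by
  apply sq_lt_sq.mp
  nlinarith

theorem aux_r (T : ℝ) (hT : 4 < T ^ 2) : ∃ r : ℝ, r ^ 2 = T ^ 2 - 4 ∧ 0 < r * T := by
  have h0 : 0 < Real.sqrt (T ^ 2 - 4) := Real.sqrt_pos.mpr (by linarith)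
  have h1 : Real.sqrt (T ^ 2 - 4) ^ 2 = T ^ 2 - 4 := Real.sq_sqrt (by linarith)
  rcases lt_trichotomy T 0 with h | h | h
  · exact ⟨-Real.sqrt (T ^ 2 - 4), by rw [neg_sq, h1], by nlinarith⟩
  · subst h; norm_num at hT
  · exact ⟨Real.sqrt (T ^ 2 - 4), h1, by positivity⟩

theorem aux_bvec_coe (x : ℝ) : bvec (x : OnePoint ℝ) = ![x, 1] := rfl

theorem aux_bvec_infty : bvec OnePoint.infty = ![1, 0] := rfl

theorem aux_mulVec (a b c d x y μ : ℝ) :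
    (!![a, b; c, d] : Matrix (Fin 2) (Fin 2) ℝ).mulVec ![x, y] = μ • ![x, y] ↔
      a * x + b * y = μ * x ∧ c * x + d * y = μ * y := by
  constructor
  · intro h
    have h0 := congrFun h 0
    have h1 := congrFun h 1
    simp [Matrix.mulVec, dotProduct, Fin.sum_univ_two] at h0 h1
    exact ⟨h0, h1⟩
  · rintro ⟨h0, h1⟩
    ext i
    fin_cases i
    · simpa [Matrix.mulVec, dotProduct, Fin.sum_univ_two] using h0
    · simpa [Matrix.mulVec, dotProduct, Fin.sum_univ_two] using h1

theorem stmt13 (R : ℝ) (hR : 1 < R) (h : PSL2) :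
    (∃ A : SL2, (QuotientGroup.mk A : PSL2) = h ∧
      2 < |Matrix.trace (A : Matrix (Fin 2) (Fin 2) ℝ)| ∧
      ∃ (ξp ξm : OnePoint ℝ) (μp μm : ℝ),
        (A : Matrix (Fin 2) (Fin 2) ℝ).mulVec (bvec ξp) = μp • bvec ξp ∧ 1 < |μp| ∧
        (A : Matrix (Fin 2) (Fin 2) ℝ).mulVec (bvec ξm) = μm • bvec ξm ∧ |μm| < 1 ∧
        ((∃ xp xm : ℝ, ξp = (xp : OnePoint ℝ) ∧ ξm = (xm : OnePoint ℝ) ∧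
            xp * xm = 1 / R ^ 2 ∧ |xp| < 1 / R) ∨
          (ξp = ((0 : ℝ) : OnePoint ℝ) ∧ ξm = OnePoint.infty))) ↔
    h ∈ SQell R := by
  have hR0 : 0 < R := by linarith
  constructor
  · rintro ⟨A, hA, -, ξp, ξm, μp, μm, hp, hμp, hm, hμm, hξ⟩
    obtain ⟨a, b, c, d, hM⟩ : ∃ a b c d : ℝ, (A : Matrix (Fin 2) (Fin 2) ℝ) = !![a, b; c, d] :=
      ⟨_, _, _, _, Matrix.eta_fin_two _⟩
    rw [hM] at hp hm
    have hμ : 0 < (μp - μm) * (μp + μm) := aux_abs_lt (hμm.trans hμp)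
    rcases hξ with ⟨x, y, rfl, rfl, hxy, hx⟩ | ⟨rfl, rfl⟩
    · rw [aux_bvec_coe, aux_mulVec] at hp hm
      obtain ⟨hp0, hp1⟩ := hp
      obtain ⟨hm0, hm1⟩ := hm
      have e1 : μp = c * x + d := by linarith
      have e2 : μm = c * y + d := by linarith
      subst e1 e2
      have hne : c * (x - y) ≠ 0 := by
        intro h0
        have : (c * x + d) - (c * y + d) = 0 := by linarith
        rw [this] at hμ
        simp at hμ
      have hc : c ≠ 0 := left_ne_zero_of_mul hne
      have hd : x - y ≠ 0 := right_ne_zero_of_mul hne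
      have ea : a = d + c * (x + y) := by
        apply mul_right_cancel₀ hd
        linarith
      have eb : b = -c * (x * y) := by
        subst ea; linarith
      have hxy2 : x ^ 2 < y ^ 2 := by
        have h1 : x ^ 2 < (1 / R) ^ 2 := by
          apply sq_lt_sq.mpr
          rwa [abs_of_pos (show 0 < 1 / R by positivity)]
        have h2 : (1 / R) ^ 2 = x * y := by rw [hxy]; field_simp
        rw [h2] at h1
        nlinarith [sq_nonneg (x - y)]
      refine ⟨A, a, d, c / R, hA, ?_, ?_, ?_⟩
      · rw [hM, eb, hxy]
        have h1 : -c * (1 / R ^ 2) = -(c / R) / R := by field_simp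
        have h2 : c / R * R = c := by field_simp
        rw [h1, h2]
      · apply aux_lt_abs
        rw [ea]
        have h1 : 0 < (c * (x - y)) * (2 * d + c * (x + y)) := by linarith
        have h2 : (x - y) * (x + y) < 0 := by linarith
        have h3 : 0 < ((c * (x - y)) * (2 * d + c * (x + y))) * (-((x - y) * (x + y))) :=
          mul_pos h1 (by linarith)
        have h4 : 0 < (x - y) ^ 2 := by positivity
        have h5 : 0 < (x - y) ^ 2 * ((d - (d + c * (x + y))) * (d + (d + c * (x + y)))) := by
          linarith
        exact pos_of_mul_pos_right h5 h4.le
      · have e : 2 * |c / R| = |2 * (c / R)| := by rw [abs_mul]; norm_num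
        rw [e]
        apply sq_lt_sq.mp
        have h4 : 0 < (c * (x - y)) ^ 2 := by positivity
        have h5 : (2 * (c / R)) ^ 2 = 4 * c ^ 2 * (x * y) := by rw [hxy]; field_simp; norm_num
        rw [h5, ea]
        linarith
    · rw [aux_bvec_coe, aux_mulVec] at hp
      rw [aux_bvec_infty, aux_mulVec] at hm
      obtain ⟨hp0, hp1⟩ := hp
      obtain ⟨hm0, hm1⟩ := hm
      have eb : b = 0 := by linarith
      have ed : d = μp := by linarith
      have ec : c = 0 := by linarith
      have ea : a = μm := by linarith
      subst eb ed ec ea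
      refine ⟨A, a, d, 0, hA, ?_, hμm.trans hμp, ?_⟩
      · rw [hM]; simp
      · simp only [abs_zero, mul_zero, abs_pos]
        intro h0
        have : d - a = 0 := by linarith
        rw [this] at hμ
        simp at hμ
  · rintro ⟨A, a, d, v, hA, hM, had, hv⟩
    have hdet : a * d + v ^ 2 = 1 := by
      have := A.det_coe
      rw [hM, Matrix.det_fin_two_of] at this
      have h2 : -v / R * (v * R) = - v ^ 2 := by field_simp
      rw [h2] at this
      linarith
    have h1 := aux_abs_lt had
    have hv2 : 4 * v ^ 2 < (a - d) ^ 2 := by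
      have e : 2 * |v| = |2 * v| := by rw [abs_mul]; norm_num
      rw [e] at hv
      have := sq_lt_sq.mpr hv
      linarith
    have hT : 4 < (a + d) ^ 2 := by linarith
    refine ⟨A, hA, ?_, ?_⟩
    · rw [hM, Matrix.trace_fin_two_of]
      have : |(2:ℝ)| < |a + d| := sq_lt_sq.mp (by linarith)
      simpa using this
    · rw [hM]
      obtain ⟨r, hr, hrT⟩ := aux_r (a + d) hT
      have hprod : (a + d + r) / 2 * ((a + d - r) / 2) = 1 := by linarith
      have habs : |(a + d - r) / 2| < |(a + d + r) / 2| := by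
        apply aux_lt_abs; linarith
      have hprod' : |(a + d + r) / 2| * |(a + d - r) / 2| = 1 := by
        rw [← abs_mul, hprod, abs_one]
      have hp1 : 1 < |(a + d + r) / 2| := by
        by_contra hcon
        nlinarith [abs_nonneg ((a + d - r) / 2), abs_nonneg ((a + d + r) / 2)]
      have hm1 : |(a + d - r) / 2| < 1 := by
        by_contra hcon
        nlinarith [abs_nonneg ((a + d - r) / 2), abs_nonneg ((a + d + r) / 2)]
      by_cases hv0 : v = 0
      · subst hv0
        have hda : a * d = 1 := by linarith
        have hda' : |a| * |d| = 1 := by rw [← abs_mul, hda, abs_one]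
        refine ⟨((0 : ℝ) : OnePoint ℝ), OnePoint.infty, d, a, ?_, ?_, ?_, ?_, Or.inr ⟨rfl, rfl⟩⟩
        · rw [aux_bvec_coe, aux_mulVec]; constructor <;> simp
        · by_contra hcon
          nlinarith [abs_nonneg a, abs_nonneg d]
        · rw [aux_bvec_infty, aux_mulVec]; constructor <;> simp
        · by_contra hcon
          nlinarith [abs_nonneg a, abs_nonneg d]
      · have hxy : (a - d + r) / (2 * v * R) * ((a - d - r) / (2 * v * R)) = 1 / R ^ 2 := by
          have : (a - d + r) * (a - d - r) = 4 * v ^ 2 := by linarith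
          rw [div_mul_div_comm, this]
          field_simp
          norm_num
        refine ⟨(((a - d + r) / (2 * v * R) : ℝ) : OnePoint ℝ),
          (((a - d - r) / (2 * v * R) : ℝ) : OnePoint ℝ), (a + d + r) / 2, (a + d - r) / 2,
          ?_, hp1, ?_, hm1, Or.inl ⟨_, _, rfl, rfl, hxy, ?_⟩⟩
        · rw [aux_bvec_coe, aux_mulVec]
          constructor
          · field_simp
            linarith
          · field_simp
            ring
        · rw [aux_bvec_coe, aux_mulVec]
          constructor
          · field_simp
            linarith
          · field_simp
            ring
        · have hneg : r * (a - d) < 0 := by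
            have h3 : 0 < ((d - a) * (d + a)) * (r * (a + d)) := mul_pos h1 hrT
            have h4 : 0 < (a + d) ^ 2 := by linarith
            have h5 : 0 < (a + d) ^ 2 * (r * (d - a)) := by linarith
            have := pos_of_mul_pos_right h5 h4.le
            linarith
          have hlt : |(a - d + r) / (2 * v * R)| < |(a - d - r) / (2 * v * R)| := by
            rw [abs_div, abs_div]
            have hpos : 0 < |2 * v * R| := by positivity
            apply div_lt_div_of_pos_right _ hpos
            apply aux_lt_abs
            linarith
          have hxy' : |(a - d + r) / (2 * v * R)| * |(a - d - r) / (2 * v * R)| = (1 / R) ^ 2 := by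
            rw [← abs_mul, hxy, abs_of_pos (by positivity)]; field_simp
          have hRp : 0 < 1 / R := by positivity
          by_contra hcon
          nlinarith [abs_nonneg ((a - d + r) / (2 * v * R)), abs_nonneg ((a - d - r) / (2 * v * R))]

end
end

section
/- Fix R > 1 and let ℓ = {z ∈ ℍ : |z| = 1/R} and ℓ' = {z ∈ ℍ : |z| = R}. Let g, g' ∈ PSL(2,ℝ). If the right AdS crooked planes g·C*(ℓ) and g'·C*(ℓ') are disjoint subsets of PSL(2,ℝ), then g⁻¹g' belongs to the product set SQ(ℓ)·SQ(ℓ')⁻¹ = {q·p : q ∈ SQ(ℓ), p ∈ SQ(ℓ')⁻¹}. -/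
noncomputable section

open Filter Topology Pointwise
open scoped UpperHalfPlane

variable {Γ : Type*} [Group Γ]

/-- Sign obstruction, half of the cases. -/
lemma sign_aux (C S m1 m2 n1 n2 : ℝ) (hS : 0 < S) (hSC : S < C) (hCS : C^2 - S^2 = 4)
    (hm1 : |m1| < C) (hm2 : |m2| < C) (hn1 : |n1| < S) (hn2 : |n2| < S)
    (hdet : m1*m2 - n1*n2 = 4)
    (hX : 0 ≤ C*n1 + S*m1) (hY : S*m2 + C*n2 ≤ 0)
    (hT : 0 < C*m1 + S*n1) (hTT : C*m1 + S*n1 ≤ C*m2 + S*n2) : False := by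
  rw [abs_lt] at *
  obtain ⟨X, hXd⟩ : ∃ X, X = C*n1 + S*m1 := ⟨_, rfl⟩
  obtain ⟨y, hyd⟩ : ∃ y, y = -(S*m2 + C*n2) := ⟨_, rfl⟩
  obtain ⟨T, hTd⟩ : ∃ T, T = C*m1 + S*n1 := ⟨_, rfl⟩
  obtain ⟨U, hUd⟩ : ∃ U, U = C*m2 + S*n2 := ⟨_, rfl⟩
  rw [← hXd] at hX
  rw [← hTd] at hT hTT
  rw [← hUd] at hTT
  have hy : 0 ≤ y := by rw [hyd]; linarith
  have e1 : T*U = 16 - X*y := by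
    subst hXd hyd hTd hUd
    linear_combination (C^2-S^2)*hdet + 4*hCS
  have e2 : T*m2 = 4*C - n1*y := by
    subst hyd hTd; linear_combination C*hdet
  have e3 : T*n2 = -m1*y - 4*S := by
    subst hyd hTd; linear_combination -S*hdet
  have e4 : S*X = C*T - 4*m1 := by
    subst hXd hTd; linear_combination -m1*hCS
  have hC : 0 < C := by linarith
  have hXy : 0 ≤ X*y := mul_nonneg hX hy
  have hT4 : T ≤ 4 := by nlinarith
  have h5 : T*m2 < T*C := mul_lt_mul_of_pos_left hm2.2 hT
  have h6 : T*(-S) < T*n2 := mul_lt_mul_of_pos_left hn2.1 hT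
  have h7 : C*(4-T) < n1*y := by nlinarith
  have h8 : m1*y < -(S*(4-T)) := by nlinarith
  have h9 : 0 ≤ C*(4-T) := mul_nonneg hC.le (by linarith)
  have h10 : n1*y ≤ S*y := mul_le_mul_of_nonneg_right hn1.2.le hy
  have h11 : S*(X*y) = C*T*y - 4*(m1*y) := by rw [← mul_assoc, e4]; ring
  have h12 : T*T ≤ 16 - X*y := by nlinarith
  have h13 : C*T*y < S*(T*(4-T)) := by nlinarith
  have h14 : C*y < S*(4-T) := by
    have : T*(C*y) < T*(S*(4-T)) := by linarith
    exact lt_of_mul_lt_mul_left this hT.le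
  have h15 : S*(S*(4-T)) ≤ C*(C*(4-T)) := by nlinarith [mul_nonneg hC.le (show (0:ℝ) ≤ 4-T by linarith)]
  nlinarith

lemma sign_lem (C S m1 m2 n1 n2 : ℝ) (hS : 0 < S) (hSC : S < C) (hCS : C^2 - S^2 = 4)
    (hm1 : |m1| < C) (hm2 : |m2| < C) (hn1 : |n1| < S) (hn2 : |n2| < S)
    (hdet : m1*m2 - n1*n2 = 4)
    (hX : 0 ≤ C*n1 + S*m1) (hY : S*m2 + C*n2 ≤ 0)
    (hTT : C*m1 + S*n1 ≤ C*m2 + S*n2) : False := by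
  rcases lt_or_ge 0 (C*m1 + S*n1) with hT | hT
  · exact sign_aux C S m1 m2 n1 n2 hS hSC hCS hm1 hm2 hn1 hn2 hdet hX hY hT hTT
  rcases lt_or_ge (C*m2 + S*n2) 0 with hU | hU
  · exact sign_aux C S (-m2) (-m1) (-n2) (-n1) hS hSC hCS (by rwa [abs_neg]) (by rwa [abs_neg])
      (by rwa [abs_neg]) (by rwa [abs_neg]) (by linarith) (by linarith) (by linarith)
      (by linarith) (by linarith)
  have hC : 0 < C := by linarith
  rw [abs_lt] at *
  -- n2 ≤ 0, m1 ≤ 0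
  have hm1' : m1 ≤ 0 := by nlinarith
  have hn2' : n2 ≤ 0 := by nlinarith
  obtain ⟨X, hXd⟩ : ∃ X, X = C*n1 + S*m1 := ⟨_, rfl⟩
  obtain ⟨U, hUd⟩ : ∃ U, U = C*m2 + S*n2 := ⟨_, rfl⟩
  obtain ⟨T, hTd⟩ : ∃ T, T = C*m1 + S*n1 := ⟨_, rfl⟩
  have e1 : U*m1 = 4*C + n2*X := by subst hXd hUd; linear_combination C*hdet
  have e2 : C*X = S*T + 4*n1 := by subst hXd hTd; linear_combination n1*hCS
  rw [← hXd] at hX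
  rw [← hTd] at hT
  rw [← hUd] at hU
  have h1 : U*m1 ≤ 0 := mul_nonpos_of_nonneg_of_nonpos hU hm1'
  have h2 : 4*C ≤ S*X := by nlinarith
  have h3 : C*X < 4*S := by nlinarith
  nlinarith

lemma key (C S m1 m2 n1 n2 : ℝ) (hS : 0 < S) (hSC : S < C) (hCS : C^2 - S^2 = 4)
    (hm1 : |m1| < C) (hm2 : |m2| < C) (hn1 : |n1| < S) (hn2 : |n2| < S)
    (hdet : m1*m2 - n1*n2 = 4) : ∃ A B s : ℝ, 0 < A*s ∧ 0 < B*s ∧ 0 < s^2 - A*B ∧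
      B*(C*n1 + S*m1) + s*(C*(m2-m1)+S*(n2-n1)) = A*(S*m2 + C*n2) ∧
      B*C*m1 + s*(C*n2-S*m1) - A*S*n2 < 0 ∧
      A*C*m2 + s*(C*n1-S*m2) - B*S*n1 < 0 ∧
      0 < s*(C*m2-S*n1) + B*C*n1 - A*S*m2 := by
  have hC : 0 < C := by linarith
  obtain ⟨X, hXd⟩ : ∃ X, X = C*n1 + S*m1 := ⟨_, rfl⟩
  obtain ⟨Y, hYd⟩ : ∃ Y, Y = S*m2 + C*n2 := ⟨_, rfl⟩
  obtain ⟨Z, hZd⟩ : ∃ Z, Z = C*(m2-m1)+S*(n2-n1) := ⟨_, rfl⟩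
  have o1 : ¬ (0 ≤ X ∧ Y ≤ 0 ∧ 0 ≤ Z) := fun ⟨a, b, c⟩ =>
    sign_lem C S m1 m2 n1 n2 hS hSC hCS hm1 hm2 hn1 hn2 hdet (hXd ▸ a) (hYd ▸ b) (by linarith)
  have o2 : ¬ (X ≤ 0 ∧ 0 ≤ Y ∧ Z ≤ 0) := fun ⟨a, b, c⟩ =>
    sign_lem C S (-m1) (-m2) (-n1) (-n2) hS hSC hCS (by rwa [abs_neg]) (by rwa [abs_neg])
      (by rwa [abs_neg]) (by rwa [abs_neg]) (by linarith) (by linarith) (by linarith)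
      (by linarith)
  have q1 : -Z*C*m1 + X*(C*n2-S*m1) = 4*(m1^2-C^2) := by
    subst hXd hZd; linear_combination (m1^2)*hCS - C^2*hdet
  have q2 : X*(C*n1-S*m2) + Z*S*n1 = 4*(n1^2-S^2) := by
    subst hXd hZd; linear_combination (n1^2)*hCS - S^2*hdet
  have q3 : X*(C*m2-S*n1) - Z*C*n1 = 4*(C*S+m1*n1) := by
    subst hXd hZd; linear_combination (m1*n1)*hCS + C*S*hdet
  have r1 : Y*(C*n2-S*m1) - Z*S*n2 = 4*(n2^2-S^2) := by
    subst hYd hZd; linear_combination (n2^2)*hCS - S^2*hdet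
  have r2 : Z*C*m2 + Y*(C*n1-S*m2) = 4*(m2^2-C^2) := by
    subst hYd hZd; linear_combination (m2^2)*hCS - C^2*hdet
  have r3 : Y*(C*m2-S*n1) - Z*S*m2 = 4*(C*S+m2*n2) := by
    subst hYd hZd; linear_combination (m2*n2)*hCS + C*S*hdet
  have sm1 : m1^2 < C^2 := sq_lt_sq' (abs_lt.1 hm1).1 (abs_lt.1 hm1).2
  have sm2 : m2^2 < C^2 := sq_lt_sq' (abs_lt.1 hm2).1 (abs_lt.1 hm2).2
  have sn1 : n1^2 < S^2 := sq_lt_sq' (abs_lt.1 hn1).1 (abs_lt.1 hn1).2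
  have sn2 : n2^2 < S^2 := sq_lt_sq' (abs_lt.1 hn2).1 (abs_lt.1 hn2).2
  have c1 : 0 < C*S + m1*n1 := by
    have : |m1*n1| < C*S := by
      rw [abs_mul]; exact mul_lt_mul'' hm1 hn1 (abs_nonneg _) (abs_nonneg _)
    linarith [(abs_lt.1 this).1]
  have c2 : 0 < C*S + m2*n2 := by
    have : |m2*n2| < C*S := by
      rw [abs_mul]; exact mul_lt_mul'' hm2 hn2 (abs_nonneg _) (abs_nonneg _)
    linarith [(abs_lt.1 this).1]
  have ev : ∀ f : ℝ → ℝ, Continuous f → 0 < f 0 → ∀ᶠ η in 𝓝[>] (0:ℝ), 0 < f η := fun f hf h0 =>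
    (hf.continuousAt.eventually (lt_mem_nhds h0)).filter_mono nhdsWithin_le_nhds
  have evp : ∀ᶠ η in 𝓝[>] (0:ℝ), 0 < η := self_mem_nhdsWithin
  -- pass to a curve of candidates
  have fin : ∀ A B s : ℝ → ℝ, Continuous A → Continuous B → Continuous s →
      (∀ η, 0 < η → 0 < s η * s 0 → 0 < A η * s η ∧ 0 < B η * s η) → s 0 ≠ 0 → A 0 * B 0 = 0 →
      (∀ η, B η * X + s η * Z = A η * Y) →
      B 0*C*m1 + s 0*(C*n2-S*m1) - A 0*S*n2 < 0 →
      A 0*C*m2 + s 0*(C*n1-S*m2) - B 0*S*n1 < 0 →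
      0 < s 0*(C*m2-S*n1) + B 0*C*n1 - A 0*S*m2 → 
      ∃ A B s : ℝ, 0 < A*s ∧ 0 < B*s ∧ 0 < s^2 - A*B ∧
      B*X + s*Z = A*Y ∧
      B*C*m1 + s*(C*n2-S*m1) - A*S*n2 < 0 ∧
      A*C*m2 + s*(C*n1-S*m2) - B*S*n1 < 0 ∧
      0 < s*(C*m2-S*n1) + B*C*n1 - A*S*m2 := by
    intro A B s hA hB hs hpos hs0 hAB hlin h1 h2 h3
    have E0 := ev (fun η => s η * s 0) (by fun_prop) (mul_self_pos.2 hs0)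
    have E1 := ev (fun η => -(B η*C*m1 + s η*(C*n2-S*m1) - A η*S*n2)) (by fun_prop) (by linarith)
    have E2 := ev (fun η => -(A η*C*m2 + s η*(C*n1-S*m2) - B η*S*n1)) (by fun_prop) (by linarith)
    have E3 := ev (fun η => s η*(C*m2-S*n1) + B η*C*n1 - A η*S*m2) (by fun_prop) h3
    have E4 := ev (fun η => (s η)^2 - A η*B η) (by fun_prop)
      (by simp only [hAB, sub_zero]; positivity)
    obtain ⟨η, p, k0, k1, k2, k3, k4⟩ :=
      (evp.and (E0.and (E1.and (E2.and (E3.and E4))))).exists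
    obtain ⟨w1, w2⟩ := hpos η p k0
    exact ⟨A η, B η, s η, w1, w2, k4, hlin η, by linarith, by linarith, k3⟩
  rw [← hXd, ← hYd, ← hZd]
  by_cases hXZ : X*Z < 0
  · refine fin (fun η => -η*Z) (fun _ => -Z) (fun η => X - η*Y) (by fun_prop) (by fun_prop)
      (by fun_prop) ?_ ?_ (by simp) (fun η => by ring) ?_ ?_ ?_
    · intro η hη h
      simp only [zero_mul, sub_zero] at h
      have hB : 0 < -Z * (X - η*Y) := by
        have h1 : 0 < ((X - η*Y)*X) * (-(X*Z)) := mul_pos h (by linarith)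
        have hX0 : 0 < X^2 := by
          have : X ≠ 0 := by rintro rfl; simp at hXZ
          positivity
        have h2 : 0 < X^2 * (-Z * (X - η*Y)) := by linarith
        exact (mul_pos_iff_of_pos_left hX0).1 h2
      exact ⟨by have := mul_pos hη hB; linarith, hB⟩
    · simp only [zero_mul, sub_zero]; rintro rfl; simp at hXZ
    · simp only [neg_zero, zero_mul, sub_zero]; linarith
    · simp only [neg_zero, zero_mul, sub_zero]; linarith
    · simp only [neg_zero, zero_mul, sub_zero]; linarith
  by_cases hYZ : 0 < Y*Z
  · refine fin (fun η => Z) (fun η => η*Z) (fun η => Y - η*X) (by fun_prop) (by fun_prop)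
      (by fun_prop) ?_ ?_ (by simp) (fun η => by ring) ?_ ?_ ?_
    · intro η hη h
      simp only [zero_mul, sub_zero] at h
      have hB : 0 < Z * (Y - η*X) := by
        have h1 : 0 < ((Y - η*X)*Y) * (Y*Z) := mul_pos h (by linarith)
        have hX0 : 0 < Y^2 := by
          have : Y ≠ 0 := by rintro rfl; simp at hYZ
          positivity
        have h2 : 0 < Y^2 * (Z * (Y - η*X)) := by linarith
        exact (mul_pos_iff_of_pos_left hX0).1 h2
      exact ⟨hB, by have := mul_pos hη hB; linarith⟩
    · simp only [zero_mul, sub_zero]; rintro rfl; simp at hYZ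
    · simp only [zero_mul, sub_zero]; linarith
    · simp only [zero_mul, sub_zero]; linarith
    · simp only [zero_mul, sub_zero]; linarith
  rcases lt_trichotomy Z 0 with hZ | hZ | hZ
  · exact (o2 ⟨nonpos_of_mul_nonneg_left (not_lt.1 hXZ) hZ, nonneg_of_mul_nonpos_left (not_lt.1 hYZ) hZ, hZ.le⟩).elim
  · have hXY : 0 < X*Y := by
      by_contra hn
      rcases le_total 0 X with h | h
      · rcases le_or_gt Y 0 with h' | h'
        · exact o1 ⟨h, h', hZ.ge⟩
        · exact o2 ⟨by nlinarith, h'.le, hZ.le⟩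
      · rcases le_or_gt 0 Y with h' | h'
        · exact o2 ⟨h, h', hZ.le⟩
        · exact o1 ⟨by nlinarith, h'.le, hZ.ge⟩
    have hX0 : X ≠ 0 := by rintro rfl; simp at hXY
    subst hZ
    refine fin (fun η => η*X) (fun η => η*Y) (fun η => X) (by fun_prop) (by fun_prop)
      (by fun_prop) ?_ hX0 (by simp) (fun η => by ring) ?_ ?_ ?_
    · intro η hη _
      exact ⟨by have : 0 < X^2 := by positivity
                have := mul_pos hη this; linarith, by have := mul_pos hη hXY; linarith⟩
    · simp only [zero_mul, sub_zero]; linarith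
    · simp only [zero_mul, sub_zero]; linarith
    · simp only [zero_mul, sub_zero]; linarith
  · exact (o1 ⟨nonneg_of_mul_nonneg_left (not_lt.1 hXZ) hZ, nonpos_of_mul_nonpos_left (not_lt.1 hYZ) hZ, hZ.le⟩).elim

lemma abs_conds (α β v k P Q W : ℝ) (hk : 0 < k) (hP : P = k*(α-β+2*v)) (hQ : Q = k*(α-β-2*v))
    (hW : W = k*(α+β)) (h1 : 0 < P*Q) (h2 : (P+Q)*W < 0) : |α| < |β| ∧ 2*|v| < |α-β| := by
  subst hP hQ hW
  have hk2 : 0 < k^2 := by positivity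
  constructor
  · rw [← sq_lt_sq]
    have : 0 < k^2*(2*(β^2-α^2)) := by linarith
    have := (mul_pos_iff_of_pos_left hk2).1 this
    linarith
  · have h2v : 2*|v| = |2*v| := by rw [abs_mul]; norm_num
    rw [h2v, ← sq_lt_sq]
    have : 0 < k^2*((α-β)^2-(2*v)^2) := by linarith
    have := (mul_pos_iff_of_pos_left hk2).1 this
    linarith

lemma factor (R i a b c d : ℝ) (hR : 1 < R) (hi : R*i = 1) (hdet : a*d - b*c = 1)
    (h1 : |a*R + d*i + b + c| < R + i) (h2 : |a*R + d*i - b - c| < R + i)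
    (h3 : |a*R - d*i - b + c| < R - i) (h4 : |a*R - d*i + b - c| < R - i) :
    ∃ α β v α' β' v' : ℝ, α*β + v^2 = 1 ∧ (|α| < |β| ∧ 2*|v| < |α-β|) ∧
      α'*β' + v'^2 = 1 ∧ (|α'| < |β'| ∧ 2*|v'| < |α'-β'|) ∧
      a = α*α' + v*i*(v'*i) ∧ b = α*(v'*R) - v*i*β' ∧ c = v*R*α' - β*(v'*i) ∧
      d = v*R*(v'*R) + β*β' := by
  have hR0 : 0 < R := by linarith
  have hi0 : 0 < i := by
    by_contra h
    nlinarith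
  have hi1 : i < 1 := by nlinarith
  obtain ⟨A, B, s, k1, k2, k3, k4, k5, k6, k7⟩ := key (R+i) (R-i) _ _ _ _ (by linarith)
    (by linarith) (by linear_combination 4*hi) h1 h2 h3 h4
    (by linear_combination 4*a*d*hi + 4*hdet)
  obtain ⟨r, hr, hr2⟩ : ∃ r : ℝ, 0 < r ∧ r^2 = (s^2-A*B)/4 :=
    ⟨√((s^2-A*B)/4), Real.sqrt_pos.2 (by linarith), Real.sq_sqrt (by linarith)⟩
  have hr0 : r ≠ 0 := hr.ne'
  obtain ⟨α, hα⟩ : ∃ α, α = (2*s-A-B)/(4*r) := ⟨_, rfl⟩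
  obtain ⟨β, hβ⟩ : ∃ β, β = (2*s+A+B)/(4*r) := ⟨_, rfl⟩
  obtain ⟨v, hv⟩ : ∃ v, v = (B-A)/(4*r) := ⟨_, rfl⟩
  have hs : s = r*(α+β) := by rw [hα, hβ]; field_simp; ring
  have hA : A = -(r*(α-β+2*v)) := by rw [hα, hβ, hv]; field_simp; ring
  have hB : B = -(r*(α-β-2*v)) := by rw [hα, hβ, hv]; field_simp; ring
  have hN : α*β+v^2 = 1 := by
    have : r^2*(α*β+v^2) = r^2*1 := by
      have h := hr2
      rw [hs, hA, hB] at h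
      linarith
    exact mul_left_cancel₀ (by positivity) this
  have hL : (β*b+v*d*i)*i = R*(v*R*a-α*c) := by
    rw [hs, hA, hB] at k4
    have : r*((β*b+v*d*i)*i) = r*(R*(v*R*a-α*c)) := by
      linear_combination (-1/8)*k4
    exact mul_left_cancel₀ hr0 this
  obtain ⟨α', hα'⟩ : ∃ x, x = β*a + v*c*i := ⟨_, rfl⟩
  obtain ⟨β', hβ'⟩ : ∃ x, x = α*d - v*R*b := ⟨_, rfl⟩
  obtain ⟨v', hv'⟩ : ∃ x, x = (β*b+v*d*i)*i := ⟨_, rfl⟩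
  have hv'' : v' = R*(v*R*a-α*c) := hv'.trans hL
  have e1 : v'*i = v*R*a-α*c := by rw [hv'']; linear_combination (v*R*a-α*c)*hi
  have e2 : v'*R = β*b+v*d*i := by rw [hv']; linear_combination (β*b+v*d*i)*hi
  have E1 : a = α*α' + v*i*(v'*i) := by
    rw [e1, hα']; linear_combination -a*hN - v^2*a*hi
  have E2 : b = α*(v'*R) - v*i*β' := by
    rw [e2, hβ']; linear_combination -b*hN - v^2*b*hi
  have E3 : c = v*R*α' - β*(v'*i) := by
    rw [e1, hα']; linear_combination -c*hN - v^2*c*hi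
  have E4 : d = v*R*(v'*R) + β*β' := by
    rw [e2, hβ']; linear_combination -d*hN - v^2*d*hi
  refine ⟨α, β, v, α', β', v', hN, ?_, ?_, ?_, E1, E2, E3, E4⟩
  · refine abs_conds α β v r (-A) (-B) s hr (by rw [hA]; ring) (by rw [hB]; ring) hs ?_ (by linarith)
    have hs0 : s ≠ 0 := by rintro rfl; simp at k1
    have : 0 < s^2*(A*B) := by have := mul_pos k1 k2; linarith
    have := (mul_pos_iff_of_pos_left (by positivity)).1 this
    linarith
  · have : v'^2 = (v'*i)*(v'*R) := by linear_combination -v'^2*hi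
    rw [this, e1, e2, hα', hβ']
    linear_combination (a*d-b*c)*hN + hdet + (v^2*a*d - v^2*b*c)*hi
  · have hvv : 2*v' = (β*b+v*d*i)*i + R*(v*R*a-α*c) := by linear_combination hv' + hv''
    refine abs_conds α' β' v' (4*r) _ _ _ (by positivity) ?_ ?_ ?_ (mul_pos_of_neg_of_neg k5 k6)
      (mul_neg_of_neg_of_pos (by linarith) k7)
    · rw [hvv, hs, hA, hB, hα', hβ']
      linear_combination 4*r*(β*a-α*d)*hi
    · rw [hvv, hs, hA, hB, hα', hβ']
      linear_combination 4*r*(β*a-α*d)*hi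
    · rw [hs, hA, hB, hα', hβ']
      linear_combination 4*r*(β*a+α*d)*hi - 4*r*hL

lemma tendsto_cosh_atTop' : Tendsto Real.cosh atTop atTop :=
  tendsto_atTop_mono (fun x => (Real.sinh_lt_cosh x).le) (Real.sinhOrderIso.tendsto_atTop)

lemma tendsto_tanh_atTop' : Tendsto Real.tanh atTop (𝓝 1) := by
  have h : ∀ x, Real.tanh x = 1 - Real.exp (-x) / Real.cosh x := fun x => by
    rw [Real.tanh_eq_sinh_div_cosh, ← Real.cosh_sub_sinh]
    have := (Real.cosh_pos x).ne'
    field_simp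
    ring
  have h2 : Tendsto (fun x => 1 - Real.exp (-x) / Real.cosh x) atTop (𝓝 (1 - 0)) := by
    refine tendsto_const_nhds.sub ?_
    exact (Real.tendsto_exp_neg_atTop_nhds_zero).div_atTop tendsto_cosh_atTop'
  simpa only [funext h, sub_zero] using h2

/-- parametrization of a half circle -/
def gam (c e : ℝ) (hc : 0 < c) (t : ℝ) : ℍ :=
  ⟨⟨c * (e * Real.tanh t), c * (Real.cosh t)⁻¹⟩, mul_pos hc (inv_pos.2 (Real.cosh_pos t))⟩

lemma endpoint (c e : ℝ) (hc : 0 < c) (he : e^2 = 1) :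
    IsEndpoint (circ c) ((c*e : ℝ) : OnePoint ℝ) := by
  have hre : ∀ t, (gam c e hc t).re = c * (e * Real.tanh t) := fun t => rfl
  have him : ∀ t, (gam c e hc t).im = c * (Real.cosh t)⁻¹ := fun t => rfl
  refine ⟨gam c e hc, ?_, ?_, ?_⟩
  · refine Isometry.of_dist_eq fun s t => ?_
    refine Real.cosh_injOn dist_nonneg dist_nonneg ?_
    rw [UpperHalfPlane.cosh_dist', Real.dist_eq, Real.cosh_abs, Real.cosh_sub, hre, hre, him, him,
      Real.tanh_eq_sinh_div_cosh, Real.tanh_eq_sinh_div_cosh]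
    have h1 := (Real.cosh_pos s).ne'
    have h2 := (Real.cosh_pos t).ne'
    have h3 := Real.cosh_sq s
    have h4 := Real.cosh_sq t
    rw [show c * (e * (Real.sinh s / Real.cosh s)) - c * (e * (Real.sinh t / Real.cosh t))
      = e * (c * (Real.sinh s / Real.cosh s) - c * (Real.sinh t / Real.cosh t)) by ring,
      mul_pow, he, one_mul]
    field_simp
    nlinarith
  · ext z
    simp only [Set.mem_range, circ, Set.mem_ofPred_eq]
    constructor
    · rintro ⟨t, rfl⟩
      have h1 := (Real.cosh_pos t).ne'
      have h3 := Real.cosh_sq t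
      rw [← sq_eq_sq₀ (norm_nonneg _) hc.le, Complex.sq_norm, Complex.normSq_apply]
      rw [UpperHalfPlane.coe_re, UpperHalfPlane.coe_im, hre, him, Real.tanh_eq_sinh_div_cosh]
      field_simp
      rw [he]
      linarith
    · intro hz
      have hz2 : z.re^2 + z.im^2 = c^2 := by
        rw [← hz, Complex.sq_norm, Complex.normSq_apply, UpperHalfPlane.coe_re,
          UpperHalfPlane.coe_im]
        ring
      have hp := z.im_pos
      refine ⟨Real.arsinh (e * z.re / z.im), ?_⟩
      have hch : Real.cosh (Real.arsinh (e * z.re / z.im)) = c / z.im := by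
        rw [← sq_eq_sq₀ (Real.cosh_pos _).le (by positivity), Real.cosh_sq, Real.sinh_arsinh,
          div_pow, div_pow, mul_pow, he, ← hz2]
        field_simp
      apply UpperHalfPlane.ext_re_im
      · rw [hre, Real.tanh_eq_sinh_div_cosh, hch, Real.sinh_arsinh]
        field_simp
        rw [he, one_mul]
      · rw [him, hch]
        field_simp
  · have : toC ((c*e : ℝ) : OnePoint ℝ) = (((c*e : ℝ) : ℂ) : OnePoint ℂ) := rfl
    rw [this]
    refine (OnePoint.continuous_coe.tendsto _).comp ?_
    have h1 : ∀ t, ((gam c e hc t : ℍ) : ℂ)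
        = ((c * (e * Real.tanh t) : ℝ) : ℂ) + ((c * (Real.cosh t)⁻¹ : ℝ) : ℂ) * Complex.I :=
      fun t => Complex.mk_eq_add_mul_I _ _
    simp only [h1]
    have h2 : ((c*e : ℝ) : ℂ) = ((c * (e * 1) : ℝ) : ℂ) + ((c * 0 : ℝ) : ℂ) * Complex.I := by
      simp
    rw [h2]
    refine Tendsto.add ?_ (Tendsto.mul_const _ ?_)
    · exact (Complex.continuous_ofReal.tendsto _).comp
        ((tendsto_tanh_atTop'.const_mul e).const_mul c)
    · exact (Complex.continuous_ofReal.tendsto _).comp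
        (tendsto_cosh_atTop'.inv_tendsto_atTop.const_mul c)

/-- intersection at two endpoints -/
lemma meet (c c' e e' : ℝ) (hc : 0 < c) (hc' : 0 < c') (he : e^2 = 1) (he' : e'^2 = 1)
    (hne : c*e - c'*e' ≠ 0) (g g' : PSL2) (G : SL2) (hG : (QuotientGroup.mk G : PSL2) = g⁻¹ * g')
    (hdisj : Disjoint ((g * ·) '' rightCrooked (circ c)) ((g' * ·) '' rightCrooked (circ c'))) :
    |c*e*(G 1 0 * (c'*e') + G 1 1) - (G 0 0 * (c'*e') + G 0 1)| < |c*e - c'*e'| := by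
  by_contra hcon
  rw [not_lt] at hcon
  obtain ⟨x, hx⟩ : ∃ x, x = c*e := ⟨_, rfl⟩
  obtain ⟨y, hy⟩ : ∃ y, y = c'*e' := ⟨_, rfl⟩
  have E1 := endpoint c e hc he
  have E2 := endpoint c' e' hc' he'
  rw [← hx] at E1
  rw [← hy] at E2
  rw [← hx, ← hy] at hcon hne
  obtain ⟨p, hp⟩ : ∃ p, p = G 0 0 * y + G 0 1 := ⟨_, rfl⟩
  obtain ⟨q, hq⟩ : ∃ q, q = G 1 0 * y + G 1 1 := ⟨_, rfl⟩
  rw [← hp, ← hq] at hcon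
  have hκ : x*q - p ≠ 0 := by
    intro h
    rw [h, abs_zero] at hcon
    exact hne (abs_nonpos_iff.1 hcon)
  obtain ⟨μ, hμ⟩ : ∃ μ, μ = (x-y)/(x*q-p) := ⟨_, rfl⟩
  have hμ1 : |μ| ≤ 1 := by
    rw [hμ, abs_div]
    exact div_le_one_of_le₀ hcon (abs_nonneg _)
  have hμk : μ*(x*q-p) = x-y := by rw [hμ]; field_simp
  let M : Matrix (Fin 2) (Fin 2) ℝ :=
    !![(μ*x-p)/(x-y), (-μ*x*y+p*x)/(x-y); (μ-q)/(x-y), (-μ*y+q*x)/(x-y)]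
  have hM : M.det = 1 := by
    rw [Matrix.det_fin_two_of]
    field_simp
    linear_combination (x-y)*hμk
  let H : SL2 := ⟨M, hM⟩
  have hHx : (H : Matrix (Fin 2) (Fin 2) ℝ).mulVec ![x, 1] = μ • ![x, 1] := by
    ext j
    fin_cases j
    · simp [H, M, Matrix.mulVec, dotProduct, Fin.sum_univ_two]; field_simp; ring
    · simp [H, M, Matrix.mulVec, dotProduct, Fin.sum_univ_two]; field_simp; ring
  have hHy : (H : Matrix (Fin 2) (Fin 2) ℝ).mulVec ![y, 1]
      = (G : Matrix (Fin 2) (Fin 2) ℝ).mulVec ![y, 1] := by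
    ext j
    fin_cases j
    · simp [H, M, Matrix.mulVec, dotProduct, Fin.sum_univ_two]
      rw [← hp]; field_simp; ring
    · simp [H, M, Matrix.mulVec, dotProduct, Fin.sum_univ_two]
      rw [← hq]; field_simp; ring
  have hb : ∀ z : ℝ, bvec (z : OnePoint ℝ) = ![z, 1] := fun z => rfl
  have m1 : (QuotientGroup.mk H : PSL2) ∈ rightCrooked (circ c) :=
    Or.inr ⟨_, E1, H, rfl, μ, hμ1, by rw [hb]; exact hHx⟩
  have m2 : (QuotientGroup.mk (G⁻¹ * H) : PSL2) ∈ rightCrooked (circ c') := by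
    refine Or.inr ⟨_, E2, G⁻¹ * H, rfl, 1, by simp, ?_⟩
    rw [hb, Matrix.SpecialLinearGroup.coe_mul, ← Matrix.mulVec_mulVec, hHy, Matrix.mulVec_mulVec,
      ← Matrix.SpecialLinearGroup.coe_mul, inv_mul_cancel]
    simp
  refine Set.disjoint_left.1 hdisj ⟨_, m1, rfl⟩ ⟨_, m2, ?_⟩
  show g' * ((QuotientGroup.mk (G⁻¹ * H) : PSL2)) = g * (QuotientGroup.mk H : PSL2)
  rw [QuotientGroup.mk_mul, QuotientGroup.mk_inv, hG]
  group

theorem stmt15 (R : ℝ) (hR : 1 < R) (g g' : PSL2)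
    (hdisj : Disjoint ((g * ·) '' rightCrooked (circ (1 / R)))
      ((g' * ·) '' rightCrooked (circ R))) :
    g⁻¹ * g' ∈ SQell R * SQell'inv R := by
  obtain ⟨G, hG⟩ := QuotientGroup.mk_surjective (g⁻¹ * g')
  have hR0 : 0 < R := by linarith
  obtain ⟨i, hid⟩ : ∃ i, i = 1 / R := ⟨_, rfl⟩
  have hi : R * i = 1 := by rw [hid]; field_simp
  have hi0 : 0 < i := by rw [hid]; positivity
  have hi1 : i < 1 := by nlinarith
  rw [← hid] at hdisj
  have K := fun (e e' : ℝ) (he : e^2 = 1) (he' : e'^2 = 1) (hne : i*e - R*e' ≠ 0) =>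
    meet i R e e' hi0 hR0 he he' hne g g' G hG hdisj
  have K1 := K 1 1 (by norm_num) (by norm_num) (by intro h; linarith)
  have K2 := K (-1) (-1) (by norm_num) (by norm_num) (by intro h; linarith)
  have K3 := K 1 (-1) (by norm_num) (by norm_num) (by intro h; linarith)
  have K4 := K (-1) 1 (by norm_num) (by norm_num) (by intro h; linarith)
  have hdet : G 0 0 * G 1 1 - G 0 1 * G 1 0 = 1 := by
    have := G.det_coe
    rwa [Matrix.det_fin_two] at this
  obtain ⟨a, ha⟩ : ∃ a, a = G 0 0 := ⟨_, rfl⟩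
  obtain ⟨b, hb⟩ : ∃ a, a = G 0 1 := ⟨_, rfl⟩
  obtain ⟨c, hc⟩ : ∃ a, a = G 1 0 := ⟨_, rfl⟩
  obtain ⟨d, hd⟩ : ∃ a, a = G 1 1 := ⟨_, rfl⟩
  rw [← ha, ← hb, ← hc, ← hd] at K1 K2 K3 K4 hdet
  have a1 : |i*1 - R*1| = R - i := by rw [abs_of_neg (by linarith)]; ring
  have a2 : |i*(-1) - R*(-1)| = R - i := by rw [abs_of_pos (by linarith)]; ring
  have a3 : |i*1 - R*(-1)| = R + i := by rw [abs_of_pos (by linarith)]; ring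
  have a4 : |i*(-1) - R*1| = R + i := by rw [abs_of_neg (by linarith)]; ring
  rw [a1, abs_lt] at K1
  rw [a2, abs_lt] at K2
  rw [a3, abs_lt] at K3
  rw [a4, abs_lt] at K4
  have s1 : i*1*(c*(R*1)+d) = c + d*i := by linear_combination c*hi
  have s2 : i*(-1)*(c*(R*(-1))+d) = c - d*i := by linear_combination c*hi
  have s3 : i*1*(c*(R*(-1))+d) = -c + d*i := by linear_combination -c*hi
  have s4 : i*(-1)*(c*(R*1)+d) = -c - d*i := by linear_combination -c*hi
  rw [s1] at K1
  rw [s2] at K2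
  rw [s3] at K3
  rw [s4] at K4
  obtain ⟨α, β, v, α', β', v', hN, ⟨h1, h2⟩, hN', ⟨h1', h2'⟩, E1, E2, E3, E4⟩ :=
    factor R i a b c d hR hi hdet
      (by rw [abs_lt]; constructor <;> linarith) (by rw [abs_lt]; constructor <;> linarith)
      (by rw [abs_lt]; constructor <;> linarith) (by rw [abs_lt]; constructor <;> linarith)
  have hdiv : ∀ w : ℝ, -w/R = -(w*i) := fun w => by rw [hid]; ring
  let q : SL2 := ⟨!![α, -v/R; v*R, β], by
    rw [Matrix.det_fin_two_of, hdiv]; linear_combination hN + v^2*hi⟩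
  let p : SL2 := ⟨!![α', v'*R; -v'/R, β'], by
    rw [Matrix.det_fin_two_of, hdiv]; linear_combination hN' + v'^2*hi⟩
  refine Set.mem_mul.2 ⟨QuotientGroup.mk q, ⟨q, α, β, v, rfl, rfl, h1, h2⟩, QuotientGroup.mk p,
    ⟨p, α', β', v', rfl, rfl, h1', h2'⟩, ?_⟩
  rw [← hG, ← QuotientGroup.mk_mul]
  congr 1
  apply Matrix.SpecialLinearGroup.ext
  intro j k
  rw [Matrix.SpecialLinearGroup.coe_mul]
  simp only [q, p, hdiv]
  fin_cases j <;> fin_cases k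
  · simp [Matrix.mul_apply, Fin.sum_univ_two]
    rw [← ha]; linarith
  · simp [Matrix.mul_apply, Fin.sum_univ_two]
    rw [← hb]; linarith
  · simp [Matrix.mul_apply, Fin.sum_univ_two]
    rw [← hc]; linarith
  · simp [Matrix.mul_apply, Fin.sum_univ_two]
    rw [← hd]; linarith

end
end
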